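/- arXiv:math/0302351 — 4 statements merged into one kernel-verified Lean document; each statement's English description precedes it below -/
import Mathlib

section
/- Let k be an algebraically closed field and 𝔞 ⊆ k[x_1, …, x_n] a nonzero monomial ideal. Then for m ∈ ℕ^n, the monomial x^m lies in the integral closure of 𝔞 if and only if m ∈ Newt(𝔞); moreover the integral closure of 𝔞 is itself a monomial ideal, namely the ideal generated by all monomials x^m with m ∈ Newt(𝔞) ∩ ℕ^n. -/
open MvPolynomial

/-- The Newton polytope of an ideal of polynomials: the convex hull in `ℝ^n` of the
set of exponent vectors `m ∈ ℕ^n` such that the monomial `x^m` belongs to the ideal. -/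
noncomputable def newtonPolytope {k : Type*} [CommRing k] {n : ℕ}
    (I : Ideal (MvPolynomial (Fin n) k)) : Set (Fin n → ℝ) :=
  convexHull ℝ { v : Fin n → ℝ | ∃ m : Fin n →₀ ℕ,
    (∀ i, v i = (m i : ℝ)) ∧ (monomial m (1 : k)) ∈ I }

/-- `f` is integral over the ideal `I`: it satisfies an equation
`f^d + c_1 f^{d-1} + ⋯ + c_d = 0` with `c_i ∈ I^i`, for some `d ≥ 1`. -/
def IsIntegralOverIdeal {R : Type*} [CommRing R] (I : Ideal R) (f : R) : Prop :=
  ∃ d : ℕ, 0 < d ∧ ∃ c : ℕ → R, (∀ i ∈ Finset.Icc 1 d, c i ∈ I ^ i) ∧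
    f ^ d + ∑ i ∈ Finset.Icc 1 d, c i * f ^ (d - i) = 0

open Polynomial in
/-- An element is integral over an ideal exactly when its degree-one copy is integral over the
Rees algebra. -/
theorem isIntegralOverIdeal_iff_isIntegral_reesAlgebra {R : Type*} [CommRing R] (I : Ideal R)
    (f : R) : IsIntegralOverIdeal I f ↔ IsIntegral (reesAlgebra I) (monomial 1 f : R[X]) := by
  constructor
  · rintro ⟨d, hd, c, hc, h⟩
    let q : (reesAlgebra I)[X] := ∑ i ∈ (Finset.Icc 1 d).attach,
      Polynomial.C (⟨monomial i.1 (c i.1), reesAlgebra.monomial_mem.2 (hc _ i.2)⟩ :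
        reesAlgebra I) * Polynomial.X ^ (d - i.1)
    have hq : q.degree < d := by
      refine (Polynomial.degree_sum_le _ _).trans_lt ((Finset.sup_lt_iff (WithBot.bot_lt_coe d)).2
        fun i _ => (Polynomial.degree_C_mul_X_pow_le _ _).trans_lt ?_)
      have := Finset.mem_Icc.1 i.2
      exact WithBot.coe_lt_coe.2 (by omega : d - i.1 < d)
    refine ⟨Polynomial.X ^ d + q, Polynomial.monic_X_pow_add hq, ?_⟩
    have hsum : Polynomial.eval₂ (algebraMap (reesAlgebra I) R[X]) (monomial 1 f) q =
        ∑ i ∈ Finset.Icc 1 d, monomial d (c i * f ^ (d - i)) := by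
      rw [Polynomial.eval₂_finsetSum, ← Finset.sum_attach (Finset.Icc 1 d)]
      refine Finset.sum_congr rfl fun i _ => ?_
      have := Finset.mem_Icc.1 i.2
      rw [Polynomial.eval₂_mul, Polynomial.eval₂_C, Polynomial.eval₂_pow, Polynomial.eval₂_X,
        Polynomial.monomial_pow]
      change monomial i.1 (c i.1) * _ = _
      rw [Polynomial.monomial_mul_monomial]
      rw [one_mul, Nat.add_sub_cancel' this.2]
    rw [Polynomial.eval₂_add, Polynomial.eval₂_pow, Polynomial.eval₂_X, hsum,
      Polynomial.monomial_pow, ← map_sum, one_mul, ← map_add, h, map_zero]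
  · rintro ⟨p, hp, h⟩
    rcases subsingleton_or_nontrivial R with _ | _
    · exact ⟨1, one_pos, 0, fun _ _ => zero_mem _, Subsingleton.elim _ _⟩
    -- Multiplying by the variable guarantees positive degree.
    refine ⟨1 + p.natDegree, by omega,
      fun i => ((p * Polynomial.X).coeff (1 + p.natDegree - i) : R[X]).coeff i,
      fun i _ => (p * Polynomial.X).coeff (1 + p.natDegree - i) |>.2 i, ?_⟩
    have h' : Polynomial.eval₂ (algebraMap (reesAlgebra I) R[X]) (monomial 1 f)
        (p * Polynomial.X) = 0 := by
      rw [Polynomial.eval₂_mul, h, zero_mul]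
    have hdeg : (p * Polynomial.X).natDegree = 1 + p.natDegree := by
      rw [hp.natDegree_mul Polynomial.monic_X, Polynomial.natDegree_X, add_comm]
    have hlead : (p * Polynomial.X).coeff (1 + p.natDegree) = 1 := by
      rw [add_comm, Polynomial.coeff_mul_X, hp.coeff_natDegree]
    rw [Polynomial.eval₂_eq_sum_range, hdeg, Finset.sum_range_succ, hlead, map_one, one_mul] at h'
    have hcoeff := congrArg (fun q => q.coeff (1 + p.natDegree)) h'
    simp only [Polynomial.coeff_add, Polynomial.monomial_pow, one_mul,
      Polynomial.finsetSum_coeff, Polynomial.coeff_monomial, if_true, Polynomial.coeff_zero]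
      at hcoeff
    rw [add_comm, ← hcoeff]
    congr 1
    refine Finset.sum_nbij' (1 + p.natDegree - ·) (1 + p.natDegree - ·) ?_ ?_ ?_ ?_ ?_
    all_goals intro i hi; simp only [Finset.mem_Icc, Finset.mem_range] at hi ⊢
    any_goals omega
    have := Polynomial.coeff_mul_monomial
      ((p * Polynomial.X).coeff (1 + p.natDegree - i) : R[X]) (1 + p.natDegree - i) i
      (f ^ (1 + p.natDegree - i))
    rw [Nat.add_sub_cancel' hi.2] at this
    exact this.symm

theorem IsIntegralOverIdeal.add {R : Type*} [CommRing R] {I : Ideal R} {f g : R}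
    (hf : IsIntegralOverIdeal I f) (hg : IsIntegralOverIdeal I g) :
    IsIntegralOverIdeal I (f + g) := by
  rw [isIntegralOverIdeal_iff_isIntegral_reesAlgebra] at *
  simpa using IsIntegral.add hf hg

theorem IsIntegralOverIdeal.mul_left {R : Type*} [CommRing R] {I : Ideal R} (r : R) {f : R}
    (hf : IsIntegralOverIdeal I f) : IsIntegralOverIdeal I (r * f) := by
  obtain ⟨d, hd, c, hc, h⟩ := hf
  refine ⟨d, hd, fun i => r ^ i * c i, fun i hi => Ideal.mul_mem_left _ _ (hc i hi), ?_⟩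
  rw [← mul_zero (r ^ d), ← h, mul_add, Finset.mul_sum, mul_pow]
  congr 1
  refine Finset.sum_congr rfl fun i hi => ?_
  rw [← pow_mul_pow_sub r (Finset.mem_Icc.1 hi).2]
  ring

theorem IsIntegralOverIdeal.of_pow_mem {R : Type*} [CommRing R] {I : Ideal R} {f : R} {d : ℕ}
    (hd : 0 < d) (h : f ^ d ∈ I ^ d) : IsIntegralOverIdeal I f := by
  refine ⟨d, hd, fun i => if i = d then -f ^ d else 0, fun i _ => ?_, ?_⟩
  · dsimp only
    split_ifs with hi
    · subst hi
      exact neg_mem h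
    · exact zero_mem _
  · rw [Finset.sum_eq_single_of_mem d (Finset.mem_Icc.2 ⟨hd, le_rfl⟩)
      fun i _ hi => by simp [hi]]
    simp

theorem isIntegralOverIdeal_of_mem_span {R : Type*} [CommRing R] {I : Ideal R} {s : Set R}
    (hs : ∀ g ∈ s, IsIntegralOverIdeal I g) {f : R} (hf : f ∈ Ideal.span s) :
    IsIntegralOverIdeal I f := by
  induction hf using Submodule.span_induction with
  | mem g hg => exact hs g hg
  | zero => exact .of_pow_mem one_pos (by simp)
  | add _ _ _ _ hf hg => exact hf.add hg
  | smul r _ _ hf => exact hf.mul_left r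

section Convex

variable {E : Type*} [AddCommGroup E] [Module ℝ E]

theorem Convex.mem_extremePoints_convexHull_insert {C : Set E} (hC : Convex ℝ C) {x : E}
    (hx : x ∉ C) : x ∈ (convexHull ℝ (insert x C)).extremePoints ℝ := by
  rcases C.eq_empty_or_nonempty with rfl | hne
  · simp
  refine mem_extremePoints_iff_left.2 ⟨subset_convexHull ℝ _ (Set.mem_insert _ _), ?_⟩
  rw [convexHull_insert hne, hC.convexHull_eq]
  intro y hy z hz h
  obtain ⟨_, rfl, c, hc, r, t, hr, ht, hrt, rfl⟩ := mem_convexJoin.1 hy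
  obtain ⟨_, rfl, e, he, q, s, hq, hs, hqs, rfl⟩ := mem_convexJoin.1 hz
  obtain ⟨a, b, ha, hb, hab, h⟩ := h
  obtain rfl | ht := ht.eq_or_lt
  · simp [show r = 1 by linarith]
  refine absurd ?_ hx
  have hw : 0 < a * t + b * s := by positivity
  have hmem := hC hc he (a := a * t / (a * t + b * s)) (b := b * s / (a * t + b * s))
    (by positivity) (by positivity) (by field_simp)
  convert hmem using 1
  obtain rfl : r = 1 - t := by linarith
  obtain rfl : q = 1 - s := by linarith
  obtain rfl : a = 1 - b := by linarith
  refine smul_right_injective E hw.ne' ?_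
  simp only [smul_add, smul_smul, mul_div_cancel₀ _ hw.ne']
  linear_combination (norm := module) (-1 : ℝ) • h

/-- A finite set not contained in a convex set `N` has a point outside `N` that is extreme in
a convex set containing both. -/
theorem Set.Finite.exists_mem_extremePoints_of_not_subset {F : Set E} (hF : F.Finite) :
    ∀ {N : Set E}, Convex ℝ N → ¬F ⊆ N →
      ∃ S, Convex ℝ S ∧ N ⊆ S ∧ F ⊆ S ∧ ∃ x ∈ F, x ∉ N ∧ x ∈ S.extremePoints ℝ := by
  induction F, hF using Set.Finite.induction_on with
  | empty => exact fun _ h => absurd (Set.empty_subset _) h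
  | @insert a F _ _ ih =>
    intro N hN h
    have hsub : insert a N ⊆ convexHull ℝ (insert a N) := subset_convexHull ℝ _
    by_cases hF : F ⊆ convexHull ℝ (insert a N)
    · by_cases ha : a ∈ N
      · rw [Set.insert_eq_of_mem ha, hN.convexHull_eq] at hF
        exact absurd (Set.insert_subset ha hF) h
      · exact ⟨_, convex_convexHull ℝ _, (Set.subset_insert _ _).trans hsub,
          Set.insert_subset (hsub (Set.mem_insert _ _)) hF, a, Set.mem_insert _ _, ha,
          hN.mem_extremePoints_convexHull_insert ha⟩
    · obtain ⟨S, hS, hNS, hFS, x, hxF, hxN, hx⟩ := ih (convex_convexHull ℝ _) hF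
      have hS' := hsub.trans hNS
      exact ⟨S, hS, (Set.subset_insert _ _).trans hS',
        Set.insert_subset (hS' (Set.mem_insert _ _)) hFS, x, Set.mem_insert_of_mem _ hxF,
        fun h => hxN (hsub (Set.mem_insert_of_mem _ h)), hx⟩

open scoped Pointwise in
theorem Convex.smul_sdiff_add_smul_subset {S : Set E} (hS : Convex ℝ S) {x : E}
    (hx : x ∈ S.extremePoints ℝ) {a b : ℝ} (ha : 0 < a) (hb : 0 ≤ b) :
    a • (S \ {x}) + b • S ⊆ (a + b) • (S \ {x}) := by
  rintro _ ⟨_, ⟨y, ⟨hy, hyx⟩, rfl⟩, _, ⟨z, hz, rfl⟩, rfl⟩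
  have hab : 0 < a + b := by positivity
  refine ⟨(a / (a + b)) • y + (b / (a + b)) • z, ⟨hS hy hz (by positivity) (by positivity)
    (by field_simp), fun h => hyx ?_⟩, by simp [smul_smul, mul_div_cancel₀ _ hab.ne']⟩
  obtain rfl | hb := hb.eq_or_lt
  · simpa [ha.ne'] using h
  · exact (mem_extremePoints_iff_left.1 hx).2 y hy z hz
      ⟨_, _, by positivity, by positivity, by field_simp, h⟩

end Convex

/-- The exponent vectors of `p`, seen in real space, all lie in `T`. -/
def MvPolynomial.SupportIn {k : Type*} [CommRing k] {σ : Type*} (T : Set (σ → ℝ))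
    (p : MvPolynomial σ k) : Prop :=
  ∀ m ∈ p.support, (fun i => (m i : ℝ)) ∈ T

namespace MvPolynomial.SupportIn

variable {k : Type*} [CommRing k] {σ : Type*} {T U : Set (σ → ℝ)} {p q : MvPolynomial σ k}

theorem mono (hp : SupportIn T p) (h : T ⊆ U) : SupportIn U p :=
  fun m hm => h (hp m hm)

theorem add (hp : SupportIn T p) (hq : SupportIn T q) : SupportIn T (p + q) := by
  classical
  exact fun m hm => (Finset.mem_union.1 (support_add hm)).elim (hp m) (hq m)

theorem sum {ι : Type*} {s : Finset ι} {f : ι → MvPolynomial σ k}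
    (h : ∀ i ∈ s, SupportIn T (f i)) : SupportIn T (∑ i ∈ s, f i) := by
  classical
  intro m hm
  obtain ⟨i, hi, hm⟩ := Finset.mem_biUnion.1 (support_sum hm)
  exact h i hi m hm

open scoped Pointwise in
theorem mul (hp : SupportIn T p) (hq : SupportIn U q) : SupportIn (T + U) (p * q) := by
  classical
  intro m hm
  obtain ⟨a, ha, b, hb, rfl⟩ := Finset.mem_add.1 (support_mul p q hm)
  exact ⟨_, hp a ha, _, hq b hb, by ext i; simp⟩

theorem monomial {m : σ →₀ ℕ} {c : k} (h : (fun i => (m i : ℝ)) ∈ T) :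
    SupportIn T (MvPolynomial.monomial m c) := by
  intro e he
  rwa [Finset.mem_singleton.1 (support_monomial_subset he)]

open scoped Pointwise in
theorem pow {S : Set (σ → ℝ)} (hS : Convex ℝ S) (hne : S.Nonempty) (hp : SupportIn S p) (d : ℕ) :
    SupportIn ((d : ℝ) • S) (p ^ d) := by
  induction d with
  | zero =>
    rw [pow_zero, Nat.cast_zero, Set.zero_smul_set hne]
    exact SupportIn.monomial (m := 0) (c := 1) (by ext; simp)
  | succ d ih =>
    rw [pow_succ, Nat.cast_succ, hS.add_smul d.cast_nonneg zero_le_one, one_smul]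
    exact ih.mul hp

open scoped Pointwise in
theorem of_mem_pow {N : Set (σ → ℝ)} (hN : Convex ℝ N) {I : Ideal (MvPolynomial σ k)}
    (hI : ∀ p ∈ I, SupportIn N p) {i : ℕ} (hi : 1 ≤ i) :
    ∀ p ∈ I ^ i, SupportIn ((i : ℝ) • N) p := by
  induction i, hi using Nat.le_induction with
  | base => simpa using hI
  | succ i _ ih =>
    intro p hp
    rw [pow_succ] at hp
    rw [Nat.cast_succ, hN.add_smul i.cast_nonneg zero_le_one, one_smul]
    exact Submodule.mul_induction_on hp (fun a ha b hb => (ih a ha).mul (hI b hb))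
      fun a b ha hb => ha.add hb

open scoped Pointwise in
/-- Modulo terms with exponents away from `d • x`, the power `p ^ d` is the power of the term of
`p` at an extreme exponent `x`. -/
theorem pow_sub_monomial {S : Set (σ → ℝ)} (hS : Convex ℝ S) (hp : SupportIn S p)
    {m : σ →₀ ℕ} (hm : (fun i => (m i : ℝ)) ∈ S.extremePoints ℝ) (d : ℕ) :
    SupportIn ((d : ℝ) • (S \ {fun i => (m i : ℝ)}))
      (p ^ d - MvPolynomial.monomial (d • m) (coeff m p ^ d)) := by
  classical
  induction d with
  | zero => intro e he; simp at he
  | succ d ih =>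
    have hr : SupportIn (S \ {fun i => (m i : ℝ)})
        (p - MvPolynomial.monomial m (coeff m p)) := by
      intro e he
      have hem : e ≠ m := by
        rintro rfl
        simp at he
      refine ⟨hp e ?_, fun h => hem (Finsupp.ext fun i => ?_)⟩
      · simpa [coeff_monomial, hem.symm] using he
      · exact_mod_cast congrFun h i
    have hM : SupportIn ((d : ℝ) • S) (MvPolynomial.monomial (d • m) (coeff m p ^ d)) :=
      SupportIn.monomial ⟨_, hm.1, by ext i; simp⟩
    have key : p ^ (d + 1) - MvPolynomial.monomial ((d + 1) • m) (coeff m p ^ (d + 1)) =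
        (p ^ d - MvPolynomial.monomial (d • m) (coeff m p ^ d)) * p +
        (p - MvPolynomial.monomial m (coeff m p)) *
          MvPolynomial.monomial (d • m) (coeff m p ^ d) := by
      rw [pow_succ (coeff m p), succ_nsmul, ← monomial_mul]
      ring
    rw [key]
    refine SupportIn.add ?_ ?_
    · rcases d.eq_zero_or_pos with rfl | hd
      · intro e he; simp at he
      · refine (ih.mul hp).mono ?_
        simpa using hS.smul_sdiff_add_smul_subset hm (Nat.cast_pos.2 hd) zero_le_one
    · refine (hr.mul hM).mono ?_
      simpa [add_comm] using hS.smul_sdiff_add_smul_subset hm one_pos d.cast_nonneg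

end MvPolynomial.SupportIn

open scoped Pointwise in
theorem IsIntegralOverIdeal.supportIn {k : Type*} [CommRing k] [IsReduced k] {σ : Type*}
    {I : Ideal (MvPolynomial σ k)} {N : Set (σ → ℝ)} (hN : Convex ℝ N)
    (hI : ∀ p ∈ I, SupportIn N p) {f : MvPolynomial σ k} (hf : IsIntegralOverIdeal I f) :
    SupportIn N f := by
  classical
  by_contra hfN
  obtain ⟨S, hS, hNS, hFS, _, ⟨m, hm, rfl⟩, hmN, hext⟩ :=
    (f.support.finite_toSet.image fun m i => (m i : ℝ)).exists_mem_extremePoints_of_not_subset hN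
      (fun h => hfN fun m hm => h ⟨m, hm, rfl⟩)
  have hfS : SupportIn S f := fun m hm => hFS ⟨m, hm, rfl⟩
  obtain ⟨d, hd, c, hc, h⟩ := hf
  have hNB : N ⊆ S \ {fun i => (m i : ℝ)} := by
    intro x hx
    refine ⟨hNS hx, ?_⟩
    rintro rfl
    exact hmN hx
  have hsum : SupportIn ((d : ℝ) • (S \ {fun i => (m i : ℝ)}))
      (∑ i ∈ Finset.Icc 1 d, c i * f ^ (d - i)) := by
    refine SupportIn.sum fun i hi => ?_
    obtain ⟨hi1, hid⟩ := Finset.mem_Icc.1 hi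
    refine ((SupportIn.of_mem_pow hN hI hi1 _ (hc i hi)).mul
      (hfS.pow hS ⟨_, hext.1⟩ (d - i))).mono ?_
    refine (Set.add_subset_add_right (Set.smul_set_mono hNB)).trans ?_
    have := hS.smul_sdiff_add_smul_subset hext (a := i) (b := (d - i : ℕ))
      (by exact_mod_cast hi1) (Nat.cast_nonneg _)
    rwa [← Nat.cast_add, Nat.add_sub_cancel' hid] at this
  have hall := (hfS.pow_sub_monomial hS hext d).add hsum
  rw [sub_add_eq_add_sub, h, zero_sub] at hall
  obtain ⟨y, ⟨_, hy⟩, hym⟩ := hall (d • m) (by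
    rw [support_neg, mem_support_iff, coeff_monomial, if_pos rfl]
    exact pow_ne_zero d (mem_support_iff.1 hm))
  refine hy (funext fun i => ?_)
  have := congrFun hym i
  simpa [hd.ne'] using this

/-- An integer point which is a real convex combination of
integer points has a positive multiple that is a combination with natural coefficients of the same
total weight. -/
theorem exists_nat_combination_of_real_combination {ι σ : Type*} [Fintype ι] [Finite σ]
    {m : σ → ℕ} {v : ι → σ → ℕ} {w : ι → ℝ} (hw : ∀ i, 0 ≤ w i) (hw1 : ∑ i, w i = 1)
    (h : ∀ j, ∑ i, w i * v i j = m j) :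
    ∃ d : ℕ, 0 < d ∧ ∃ a : ι → ℕ, ∑ i, a i = d ∧ ∀ j, ∑ i, a i * v i j = d * m j := by
  classical
  have := Fintype.ofFinite σ
  -- The constant extra coordinate `1` records the total weight.
  let m' : Option σ → ℤ := fun j => j.elim 1 fun j => m j
  let v' : ι → Option σ → ℤ := fun i j => j.elim 1 fun j => v i j
  have hv' : ∀ i j, 0 ≤ v' i j := by
    rintro i (_ | j) <;> simp [v']
  have h' : ∀ j, ∑ i, w i * v' i j = m' j := by
    rintro (_ | j)
    · simpa [v', m'] using hw1
    · simpa [v', m'] using h j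
  let r : ℕ → Option σ → ℤ := fun N j => N * m' j - ∑ i, ⌊N * w i⌋ * v' i j
  have hr : ∀ N j, (r N j : ℝ) = ∑ i, Int.fract (N * w i) * v' i j := by
    intro N j
    simp only [r, Int.cast_sub, Int.cast_mul, Int.cast_natCast, Int.cast_sum, ← h',
      Finset.mul_sum, ← Finset.sum_sub_distrib, Int.fract]
    exact Finset.sum_congr rfl fun i _ => by ring
  have hmem : ∀ N, r N ∈ Set.Icc (0 : Option σ → ℤ) (fun j => ∑ i, v' i j) := by
    refine fun N => ⟨fun j => ?_, fun j => ?_⟩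
    · have : (0 : ℝ) ≤ r N j := by
        rw [hr]
        exact Finset.sum_nonneg fun i _ =>
          mul_nonneg (Int.fract_nonneg _) (by exact_mod_cast hv' i j)
      exact_mod_cast this
    · have : (r N j : ℝ) ≤ ∑ i, (v' i j : ℝ) := by
        rw [hr]
        exact Finset.sum_le_sum fun i _ =>
          mul_le_of_le_one_left (by exact_mod_cast hv' i j) (Int.fract_lt_one _).le
      exact_mod_cast this
  obtain ⟨A, B, hAB, hrAB⟩ := Set.Finite.exists_lt_map_eq_of_forall_mem hmem (Set.finite_Icc _ _)
  have hfl : ∀ i, ⌊A * w i⌋ ≤ ⌊B * w i⌋ := fun i =>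
    Int.floor_mono (mul_le_mul_of_nonneg_right (by exact_mod_cast hAB.le) (hw i))
  choose a ha using fun i => Int.eq_ofNat_of_zero_le (sub_nonneg.2 (hfl i))
  have key : ∀ j, ∑ i, (a i : ℤ) * v' i j = (B - A : ℕ) * m' j := by
    intro j
    have := congrFun hrAB j
    simp only [r] at this
    rw [Nat.cast_sub hAB.le]
    simp only [← ha, sub_mul, Finset.sum_sub_distrib]
    linarith
  refine ⟨B - A, by omega, a, ?_, fun j => ?_⟩
  · have := key none
    simp only [v', m', Option.elim, mul_one] at this
    exact_mod_cast this
  · have := key (some j)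
    simp only [v', m', Option.elim] at this
    exact_mod_cast this

theorem isIntegralOverIdeal_monomial_of_mem_newtonPolytope {k : Type*} [CommRing k] {n : ℕ}
    {I : Ideal (MvPolynomial (Fin n) k)} {m : Fin n →₀ ℕ}
    (hm : (fun i => (m i : ℝ)) ∈ newtonPolytope I) :
    IsIntegralOverIdeal I (monomial m (1 : k)) := by
  obtain ⟨ι, _, w, z, hw, hw1, hz, h⟩ := mem_convexHull_iff_exists_fintype.1 hm
  choose v hv hvI using hz
  obtain ⟨d, hd, a, had, ha⟩ := exists_nat_combination_of_real_combination (m := m)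
    (v := fun i => v i) hw hw1 fun j => by
      simpa [hv] using congrFun h j
  refine .of_pow_mem hd ?_
  have hpow : monomial m (1 : k) ^ d = ∏ i, monomial (v i) (1 : k) ^ a i := by
    simp only [monomial_pow, one_pow]
    rw [← monomial_sum_one]
    refine congrArg (fun e => monomial e (1 : k)) (Finsupp.ext fun j => ?_)
    simpa [Finsupp.finsetSum_apply] using (ha j).symm
  rw [hpow, ← had, ← Finset.prod_pow_eq_pow_sum]
  exact Ideal.prod_mem_prod fun i _ => Ideal.pow_mem_pow (hvI i) _

theorem supportIn_newtonPolytope_of_mem {k : Type*} [CommRing k] {n : ℕ}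
    {S : Set (Fin n →₀ ℕ)} {p : MvPolynomial (Fin n) k}
    (hp : p ∈ Ideal.span ((fun m => monomial m (1 : k)) '' S)) :
    SupportIn (newtonPolytope (Ideal.span ((fun m => monomial m (1 : k)) '' S))) p := by
  classical
  intro m hm
  refine subset_convexHull ℝ _ ⟨m, fun _ => rfl, mem_ideal_span_monomial_image.2 fun e he => ?_⟩
  rw [Finset.mem_singleton.1 (support_monomial_subset he)]
  exact mem_ideal_span_monomial_image.1 hp m hm

/-- For a nonzero monomial ideal `𝔞`, the monomial `x^m` is in the integral closure of `𝔞`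
iff `m ∈ Newt(𝔞)`; moreover the integral closure of `𝔞` is the monomial ideal generated by
all monomials whose exponents lie in `Newt(𝔞)`. -/
theorem integralClosure_monomialIdeal {k : Type*} [Field k] [IsAlgClosed k] {n : ℕ}
    (I : Ideal (MvPolynomial (Fin n) k)) (hI : I ≠ ⊥)
    (hmono : ∃ S : Set (Fin n →₀ ℕ), I = Ideal.span ((fun m => monomial m (1 : k)) '' S)) :
    (∀ m : Fin n →₀ ℕ,
      IsIntegralOverIdeal I (monomial m (1 : k)) ↔ (fun i => (m i : ℝ)) ∈ newtonPolytope I) ∧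
    { f | IsIntegralOverIdeal I f } =
      (Ideal.span ((fun m => monomial m (1 : k)) ''
        { m : Fin n →₀ ℕ | (fun i => (m i : ℝ)) ∈ newtonPolytope I }) : Set _) := by
  obtain ⟨S, rfl⟩ := hmono
  have hsupp := fun f (hf : IsIntegralOverIdeal (Ideal.span ((fun m => monomial m (1 : k)) '' S))
    f) => hf.supportIn (convex_convexHull ℝ _) fun p hp => supportIn_newtonPolytope_of_mem hp
  refine ⟨fun m => ⟨fun h => hsupp _ h m (by simp [mem_support_iff]),
    isIntegralOverIdeal_monomial_of_mem_newtonPolytope⟩, ?_⟩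
  ext f
  refine ⟨fun hf => mem_ideal_span_monomial_image.2 fun m hm => ⟨m, hsupp f hf m hm, le_rfl⟩,
    fun hf => isIntegralOverIdeal_of_mem_span ?_ hf⟩
  rintro _ ⟨m, hm, rfl⟩
  exact isIntegralOverIdeal_monomial_of_mem_newtonPolytope hm
end

section
/- (Briançon–Skoda) Let k be an algebraically closed field of characteristic zero and 𝔟 ⊆ k[x_1, …, x_n] a nonzero ideal. Then for every integer m ≥ n, the integral closure of 𝔟^m is contained in 𝔟^{m+1−n}. -/
section IdealPowers

variable {R S : Type*} [CommRing R] [CommRing S]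

theorem IsIntegralOverIdeal.map {I : Ideal R} {f : R} (hf : IsIntegralOverIdeal I f)
    (φ : R →+* S) : IsIntegralOverIdeal (I.map φ) (φ f) := by
  obtain ⟨d, hd, c, hc, h⟩ := hf
  refine ⟨d, hd, fun i ↦ φ (c i), fun i hi ↦ ?_, ?_⟩
  · rw [← Ideal.map_pow]
    exact Ideal.mem_map_of_mem φ (hc i hi)
  · simpa using congrArg φ h

theorem Ideal.sup_pow_le_mul_sup_pow_sup_pow (A B : Ideal R) (D : ℕ) :
    (A ⊔ B) ^ (D + 1) ≤ A * (A ⊔ B) ^ D ⊔ B ^ (D + 1) := by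
  induction D with
  | zero => simp
  | succ D ih =>
    calc (A ⊔ B) ^ (D + 1 + 1) = A * (A ⊔ B) ^ (D + 1) ⊔ B * (A ⊔ B) ^ (D + 1) := by
          rw [pow_succ', Ideal.sup_mul]
      _ ≤ A * (A ⊔ B) ^ (D + 1) ⊔ B * (A * (A ⊔ B) ^ D ⊔ B ^ (D + 1)) :=
          sup_le_sup_left (Ideal.mul_mono_right ih) _
      _ ≤ A * (A ⊔ B) ^ (D + 1) ⊔ B ^ (D + 1 + 1) := by
          rw [Ideal.mul_sup, ← pow_succ']
          refine sup_le le_sup_left (sup_le (le_sup_of_le_left ?_) le_sup_right)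
          rw [mul_left_comm]
          refine Ideal.mul_mono_right ?_
          rw [pow_succ' (A ⊔ B)]
          exact Ideal.mul_mono_left le_sup_right

/-- An element integral over `I` multiplies a power of `I + (f)` into `I` times that power. -/
theorem IsIntegralOverIdeal.exists_span_mul_le {I : Ideal R} {f : R}
    (hf : IsIntegralOverIdeal I f) :
    ∃ d : ℕ, Ideal.span {f} * (I ⊔ Ideal.span {f}) ^ d ≤ I * (I ⊔ Ideal.span {f}) ^ d := by
  obtain ⟨d, hd, c, hc, h⟩ := hf
  obtain ⟨d, rfl⟩ := Nat.exists_eq_succ_of_ne_zero hd.ne'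
  refine ⟨d, ?_⟩
  have key : Ideal.span {f} ^ (d + 1) ≤ I * (I ⊔ Ideal.span {f}) ^ d := by
    rw [Ideal.span_singleton_pow, Ideal.span_singleton_le_iff_mem, eq_neg_of_add_eq_zero_left h]
    refine neg_mem (Ideal.sum_mem _ fun i hi ↦ ?_)
    have hi' := Finset.mem_Icc.1 hi
    obtain ⟨j, rfl⟩ : ∃ j, i = j + 1 := ⟨i - 1, by omega⟩
    have h1 : I ^ (j + 1) * Ideal.span {f} ^ (d + 1 - (j + 1)) ≤
        I * (I ⊔ Ideal.span {f}) ^ d := by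
      have hd' : d = j + (d + 1 - (j + 1)) := by omega
      conv_rhs => rw [hd', pow_add]
      rw [pow_succ', mul_assoc]
      exact Ideal.mul_mono_right
        (Ideal.mul_mono (Ideal.pow_right_mono le_sup_left _) (Ideal.pow_right_mono le_sup_right _))
    exact h1 (Ideal.mul_mem_mul (hc _ hi)
      (Ideal.pow_mem_pow (Ideal.mem_span_singleton_self f) _))
  calc Ideal.span {f} * (I ⊔ Ideal.span {f}) ^ d
      ≤ (I ⊔ Ideal.span {f}) ^ (d + 1) := by
        rw [pow_succ']
        exact Ideal.mul_mono_left le_sup_right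
    _ ≤ _ := (Ideal.sup_pow_le_mul_sup_pow_sup_pow _ _ d).trans (sup_le le_rfl key)

/-- The determinant trick. -/
theorem IsIntegralOverIdeal.of_span_mul_le [IsDomain R] {I M : Ideal R} {h : R}
    (hM : M.FG) (hM0 : M ≠ ⊥) (hle : Ideal.span {h} * M ≤ I * M) :
    IsIntegralOverIdeal I h := by
  have : Module.Finite R M := Module.Finite.iff_fg.2 hM
  obtain ⟨u, huM, hu0⟩ := Submodule.exists_mem_ne_zero_of_ne_bot hM0
  obtain ⟨p, hp, hdeg, hcoeff, hp0⟩ :=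
    LinearMap.exists_monic_and_natDegree_eq_and_coeff_mem_pow_and_aeval_eq_zero R
      (algebraMap R (Module.End R M) h) I (by
        rintro _ ⟨x, rfl⟩
        rw [Submodule.mem_smul_top_iff]
        exact hle (Ideal.mul_mem_mul (Ideal.mem_span_singleton_self h) x.2))
  have hev : p.eval h = 0 := by
    rw [Polynomial.aeval_algebraMap_apply] at hp0
    have h2 := congrArg Subtype.val (LinearMap.congr_fun hp0 ⟨u, huM⟩)
    simpa [Module.algebraMap_end_apply, hu0] using h2
  rw [Polynomial.eval_eq_sum_range, Finset.sum_range_succ, hp.coeff_natDegree, one_mul] at hev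
  rcases Nat.eq_zero_or_pos p.natDegree with h0 | hpos
  · simp [h0] at hev
  refine ⟨p.natDegree, hpos, fun i ↦ p.coeff (p.natDegree - i), fun i hi ↦ ?_, ?_⟩
  · have hi' := Finset.mem_Icc.1 hi
    have := hcoeff (p.natDegree - i)
    rwa [Nat.sub_sub_self hi'.2] at this
  · rw [add_comm, ← hev]
    congr 1
    refine Finset.sum_bij' (fun i _ ↦ p.natDegree - i) (fun i _ ↦ p.natDegree - i) ?_ ?_ ?_ ?_ ?_
    · intro i hi
      simp only [Finset.mem_Icc, Finset.mem_range] at *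
      omega
    · intro i hi
      simp only [Finset.mem_Icc, Finset.mem_range] at *
      omega
    · intro i hi
      simp only [Finset.mem_Icc] at *
      omega
    · intro i hi
      simp only [Finset.mem_range] at *
      omega
    · intro i hi
      rfl

/-- `J ≤ I` is a reduction of `I` after inverting an element congruent to `1` modulo `I`. -/
def Ideal.IsReductionNear (J I : Ideal R) : Prop :=
  J ≤ I ∧ ∃ s : R, s - 1 ∈ I ∧ ∃ N : ℕ, Ideal.span {s} * I ^ (N + 1) ≤ J * I ^ N

theorem Ideal.IsReductionNear.refl (I : Ideal R) : I.IsReductionNear I :=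
  ⟨le_rfl, 1, by simp, 0, by simp⟩

theorem Ideal.span_pow_mul_pow_add_le {J I : Ideal R} {s : R} {N : ℕ}
    (h : Ideal.span {s} * I ^ (N + 1) ≤ J * I ^ N) (t : ℕ) :
    Ideal.span {s} ^ t * I ^ (N + t) ≤ J ^ t * I ^ N := by
  induction t with
  | zero => simp
  | succ t ih =>
    calc Ideal.span {s} ^ (t + 1) * I ^ (N + (t + 1))
        = Ideal.span {s} ^ t * I ^ t * (Ideal.span {s} * I ^ (N + 1)) := by ring
      _ ≤ Ideal.span {s} ^ t * I ^ t * (J * I ^ N) := Ideal.mul_mono_right h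
      _ = J * (Ideal.span {s} ^ t * I ^ (N + t)) := by ring
      _ ≤ J * (J ^ t * I ^ N) := Ideal.mul_mono_right ih
      _ = _ := by ring

theorem Ideal.IsReductionNear.trans {A B C : Ideal R} (hAB : A.IsReductionNear B)
    (hBC : B.IsReductionNear C) : A.IsReductionNear C := by
  obtain ⟨hAB, s, hs, N, hN⟩ := hAB
  obtain ⟨hBC, t, ht, M, hM⟩ := hBC
  refine ⟨hAB.trans hBC, s * t ^ (N + 1), ?_, N + M, ?_⟩
  · rw [← Ideal.Quotient.eq, map_one] at ht ⊢
    have hs' : Ideal.Quotient.mk C s = 1 := by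
      rw [← map_one (Ideal.Quotient.mk C), Ideal.Quotient.eq]
      exact hBC hs
    rw [map_mul, map_pow, ht, hs', one_pow, mul_one]
  · rw [← Ideal.span_singleton_mul_span_singleton, ← Ideal.span_singleton_pow]
    calc Ideal.span {s} * Ideal.span {t} ^ (N + 1) * C ^ (N + M + 1)
        = Ideal.span {s} * (Ideal.span {t} ^ (N + 1) * C ^ (M + (N + 1))) := by ring
      _ ≤ Ideal.span {s} * (B ^ (N + 1) * C ^ M) :=
          Ideal.mul_mono_right (Ideal.span_pow_mul_pow_add_le hM _)
      _ = Ideal.span {s} * B ^ (N + 1) * C ^ M := by ring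
      _ ≤ A * B ^ N * C ^ M := Ideal.mul_mono_left hN
      _ ≤ A * C ^ N * C ^ M :=
          Ideal.mul_mono_left (Ideal.mul_mono_right (Ideal.pow_right_mono hBC N))
      _ = _ := by ring

theorem Ideal.IsReductionNear.exists_isIntegralOverIdeal [IsDomain R] [IsNoetherianRing R]
    {J I : Ideal R} (hJI : J.IsReductionNear I) (hI : I ≠ ⊥) {m : ℕ} {f : R}
    (hf : IsIntegralOverIdeal (I ^ m) f) :
    ∃ s : R, s - 1 ∈ I ∧ IsIntegralOverIdeal (J ^ m) (s * f) := by
  obtain ⟨-, s, hs, N, hN⟩ := hJI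
  obtain ⟨d, hd⟩ := hf.exists_span_mul_le
  refine ⟨s ^ m, ?_, ?_⟩
  · rw [← Ideal.Quotient.eq, map_one] at hs ⊢
    rw [map_pow, hs, one_pow]
  · have hK : I ^ m ⊔ Ideal.span {f} ≠ ⊥ :=
      ne_bot_of_le_ne_bot (pow_ne_zero m hI) le_sup_left
    refine IsIntegralOverIdeal.of_span_mul_le
      (M := I ^ N * (I ^ m ⊔ Ideal.span {f}) ^ d) (IsNoetherian.noetherian _)
      (mul_ne_zero (pow_ne_zero _ hI) (pow_ne_zero _ hK)) ?_
    rw [← Ideal.span_singleton_mul_span_singleton, ← Ideal.span_singleton_pow]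
    set K := (I ^ m ⊔ Ideal.span {f}) ^ d
    calc Ideal.span {s} ^ m * Ideal.span {f} * (I ^ N * K)
        = Ideal.span {s} ^ m * I ^ N * (Ideal.span {f} * K) := by ring
      _ ≤ Ideal.span {s} ^ m * I ^ N * (I ^ m * K) := Ideal.mul_mono_right hd
      _ = Ideal.span {s} ^ m * I ^ (N + m) * K := by ring
      _ ≤ J ^ m * I ^ N * K := Ideal.mul_mono_left (Ideal.span_pow_mul_pow_add_le hN m)
      _ = _ := by ring

theorem Ideal.mem_pow_of_mul_mem_pow {I : Ideal R} {s f : R} (hs : s - 1 ∈ I) {M : ℕ}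
    (h : s * f ∈ I ^ M) : f ∈ I ^ M := by
  suffices ∀ j ≤ M, f ∈ I ^ j from this M le_rfl
  intro j
  induction j with
  | zero => simp
  | succ j ih =>
    intro hj
    have h1 : (s - 1) * f ∈ I ^ (j + 1) := by
      rw [pow_succ']
      exact Ideal.mul_mem_mul hs (ih (by omega))
    have h2 := Ideal.sub_mem _ (Ideal.pow_le_pow_right hj h) h1
    rwa [← sub_mul, sub_sub_cancel, one_mul] at h2

end IdealPowers

section NumberOfGenerators

open MvPolynomial

theorem Multiset.map_prod_mem_pow {ι R : Type*} [CommRing R] {J : Ideal R} {u : ι → R}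
    (hu : ∀ i, u i ∈ J) (s : Multiset ι) : (s.map u).prod ∈ J ^ s.card := by
  induction s using Multiset.induction with
  | empty => simp
  | cons a s ih =>
    rw [Multiset.map_cons, Multiset.prod_cons, Multiset.card_cons, pow_succ']
    exact Ideal.mul_mem_mul (hu a) ih

theorem Multiset.map_prod_sub_map_prod_mem {ι R : Type*} [CommRing R] {J' J : Ideal R}
    {u v : ι → R} (hu : ∀ i, u i ∈ J) (hv : ∀ i, v i ∈ J) (huv : ∀ i, u i - v i ∈ J')
    (s : Multiset ι) : (s.map u).prod - (s.map v).prod ∈ J' * J ^ (s.card - 1) := by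
  induction s using Multiset.induction with
  | empty => simp
  | cons a s ih =>
    have h : ((a ::ₘ s).map u).prod - ((a ::ₘ s).map v).prod =
        (u a - v a) * (s.map u).prod + v a * ((s.map u).prod - (s.map v).prod) := by
      simp only [Multiset.map_cons, Multiset.prod_cons]
      ring
    rw [h, Multiset.card_cons, Nat.add_sub_cancel]
    refine add_mem (Ideal.mul_mem_mul (huv a) (Multiset.map_prod_mem_pow hu s)) ?_
    rcases Multiset.empty_or_exists_mem s with rfl | ⟨b, hb⟩
    · simp
    · obtain ⟨k, hk⟩ : ∃ k, s.card = k + 1 :=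
        Nat.exists_eq_succ_of_ne_zero (Multiset.card_pos_iff_exists_mem.2 ⟨b, hb⟩).ne'
      rw [hk, Nat.add_sub_cancel] at ih
      rw [hk, pow_succ', mul_left_comm]
      exact Ideal.mul_mem_mul (hv a) ih

theorem MvPolynomial.aeval_eq_sum_toMultiset {ι K R : Type*} [CommRing K] [CommRing R]
    [Algebra K R] (u : ι → R) (G : MvPolynomial ι K) :
    aeval u G = ∑ α ∈ G.support,
      algebraMap K R (G.coeff α) * ((Finsupp.toMultiset α).map u).prod := by
  classical
  rw [aeval_def, eval₂_eq]
  refine Finset.sum_congr rfl fun α _ ↦ ?_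
  rw [Finset.prod_multiset_map_count, Finsupp.toFinset_toMultiset]
  simp

theorem MvPolynomial.IsHomogeneous.card_toMultiset {ι K : Type*} [CommRing K]
    {G : MvPolynomial ι K} {D : ℕ} (hG : G.IsHomogeneous D) {α : ι →₀ ℕ} (hα : α ∈ G.support) :
    (Finsupp.toMultiset α).card = D := by
  rw [Finsupp.card_toMultiset, ← hG (mem_support_iff.1 hα)]
  exact DFunLike.congr_fun (Finsupp.degree_eq_weight_one (R := ℕ)) α

theorem MvPolynomial.IsHomogeneous.aeval_mem_pow {ι K R : Type*} [CommRing K] [CommRing R]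
    [Algebra K R] {G : MvPolynomial ι K} {D : ℕ} (hG : G.IsHomogeneous D) {J : Ideal R}
    {u : ι → R} (hu : ∀ i, u i ∈ J) : MvPolynomial.aeval u G ∈ J ^ D := by
  rw [aeval_eq_sum_toMultiset]
  refine Ideal.sum_mem _ fun α hα ↦ Ideal.mul_mem_left _ _ ?_
  rw [← hG.card_toMultiset hα]
  exact Multiset.map_prod_mem_pow hu _

theorem MvPolynomial.IsHomogeneous.aeval_sub_aeval_mem {ι K R : Type*} [CommRing K]
    [CommRing R] [Algebra K R] {G : MvPolynomial ι K} {D : ℕ} (hG : G.IsHomogeneous D)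
    {J' J : Ideal R} {u v : ι → R} (hu : ∀ i, u i ∈ J) (hv : ∀ i, v i ∈ J)
    (huv : ∀ i, u i - v i ∈ J') :
    MvPolynomial.aeval u G - MvPolynomial.aeval v G ∈ J' * J ^ (D - 1) := by
  rw [aeval_eq_sum_toMultiset, aeval_eq_sum_toMultiset, ← Finset.sum_sub_distrib]
  refine Ideal.sum_mem _ fun α hα ↦ ?_
  rw [← mul_sub, ← hG.card_toMultiset hα]
  exact Ideal.mul_mem_left _ _ (Multiset.map_prod_sub_map_prod_mem hu hv huv _)

theorem MvPolynomial.IsHomogeneous.aeval_mul {ι K R : Type*} [CommRing K] [CommRing R]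
    [Algebra K R] {G : MvPolynomial ι K} {D : ℕ} (hG : G.IsHomogeneous D) (c : R) (u : ι → R) :
    MvPolynomial.aeval (fun i ↦ c * u i) G = c ^ D * MvPolynomial.aeval u G := by
  rw [aeval_eq_sum_toMultiset, aeval_eq_sum_toMultiset, Finset.mul_sum]
  refine Finset.sum_congr rfl fun α hα ↦ ?_
  rw [Multiset.prod_map_mul, Multiset.map_const', Multiset.prod_replicate,
    hG.card_toMultiset hα]
  ring

/-- The lowest homogeneous part of an algebraic relation among elements of `J` takes a value
of higher `J`-adic order than expected. -/
theorem MvPolynomial.exists_isHomogeneous_aeval_mem_pow_succ {ι K R : Type*} [CommRing K]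
    [CommRing R] [Algebra K R] {P : MvPolynomial ι K} (hP : P ≠ 0) {J : Ideal R} {g : ι → R}
    (hg : ∀ i, g i ∈ J) (hPg : aeval g P = 0) :
    ∃ (D : ℕ) (G : MvPolynomial ι K), G.IsHomogeneous D ∧ G ≠ 0 ∧ aeval g G ∈ J ^ (D + 1) := by
  classical
  have hex : ∃ D, homogeneousComponent D P ≠ 0 := by
    by_contra! h
    apply hP
    rw [← sum_homogeneousComponent P]
    exact Finset.sum_eq_zero fun i _ ↦ h i
  refine ⟨Nat.find hex, homogeneousComponent (Nat.find hex) P,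
    homogeneousComponent_isHomogeneous _ _, Nat.find_spec hex, ?_⟩
  set D := Nat.find hex with hD
  have hDmem : D ∈ Finset.range (P.totalDegree + 1) := by
    by_contra hcon
    refine Nat.find_spec hex (homogeneousComponent_eq_zero _ _ ?_)
    simpa [hD] using hcon
  have hsum : aeval g (homogeneousComponent D P) =
      -∑ i ∈ (Finset.range (P.totalDegree + 1)).erase D, aeval g (homogeneousComponent i P) := by
    rw [eq_neg_iff_add_eq_zero,
      Finset.add_sum_erase _ (fun i ↦ aeval g (homogeneousComponent i P)) hDmem, ← map_sum,
      sum_homogeneousComponent, hPg]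
  rw [hsum]
  refine neg_mem (Ideal.sum_mem _ fun i hi ↦ ?_)
  rcases lt_or_gt_of_ne (Finset.ne_of_mem_erase hi) with hlt | hgt
  · have : homogeneousComponent i P = 0 := not_not.1 (Nat.find_min hex hlt)
    simp [this]
  · exact Ideal.pow_le_pow_right hgt
      ((homogeneousComponent_isHomogeneous i P).aeval_mem_pow hg)

theorem Ideal.exists_isReductionNear_of_not_algebraicIndependent {K R : Type*} [Field K]
    [Infinite K] [CommRing R] [IsNoetherianRing R] [Algebra K R] {r : ℕ} (g : Fin (r + 1) → R)
    (hg : ¬ AlgebraicIndependent K g) :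
    ∃ g' : Fin r → R,
      (Ideal.span (Set.range g')).IsReductionNear (Ideal.span (Set.range g)) := by
  set J := Ideal.span (Set.range g)
  have hgJ : ∀ i, g i ∈ J := fun i ↦ Ideal.subset_span ⟨i, rfl⟩
  rw [algebraicIndependent_iff] at hg
  push Not at hg
  obtain ⟨P, hPg, hP⟩ := hg
  obtain ⟨D, G, hG, hG0, hGg⟩ := exists_isHomogeneous_aeval_mem_pow_succ hP hgJ hPg
  rcases Nat.eq_zero_or_pos D with rfl | hD
  · have hC := (totalDegree_zero_iff_isHomogeneous _).2 hG
    rw [totalDegree_eq_zero_iff_eq_C] at hC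
    have hc0 : G.coeff 0 ≠ 0 := fun h ↦ hG0 (by rw [hC, h, C_0])
    have hJ : J = ⊤ := by
      rw [hC, aeval_C, zero_add, pow_one] at hGg
      exact Ideal.eq_top_of_isUnit_mem _ hGg ((isUnit_iff_ne_zero.2 hc0).map (algebraMap K R))
    refine ⟨0, ?_, 0, ?_, 0, ?_⟩
    · rw [hJ]; exact le_top
    · rw [hJ]; trivial
    · simp
  obtain ⟨E, rfl⟩ : ∃ E, D = E + 1 := ⟨D - 1, by omega⟩
  obtain ⟨a, ha⟩ : ∃ a, eval a G ≠ 0 := by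
    by_contra! h
    exact hG0 (MvPolynomial.funext fun x ↦ by rw [h x, map_zero])
  obtain ⟨j, hj⟩ : ∃ j, a j ≠ 0 := by
    by_contra! h
    apply ha
    have h2 := hG.aeval_mul (0 : K) a
    have h3 : (fun i ↦ 0 * a i) = a := by
      ext i
      simp [h i]
    rw [h3] at h2
    rwa [zero_pow E.succ_ne_zero, zero_mul, aeval_eq_eval] at h2
  let ι := algebraMap K R
  let g' : Fin r → R := fun i ↦ ι (a j) * g (j.succAbove i) - ι (a (j.succAbove i)) * g j
  set J' := Ideal.span (Set.range g') with hJ'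
  have hmem : ∀ i, ι (a j) * g i - ι (a i) * g j ∈ J' := by
    intro i
    by_cases hij : i = j
    · simp [hij]
    · obtain ⟨z, rfl⟩ := Fin.exists_succAbove_eq hij
      exact Ideal.subset_span ⟨z, rfl⟩
  have hJ'J : J' ≤ J := by
    rw [hJ', Ideal.span_le]
    rintro _ ⟨i, rfl⟩
    exact sub_mem (Ideal.mul_mem_left _ _ (hgJ _)) (Ideal.mul_mem_left _ _ (hgJ _))
  have hJle : J ≤ J' ⊔ Ideal.span {g j} := by
    refine Ideal.span_le.2 ?_
    rintro _ ⟨i, rfl⟩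
    have h1 : ι (a j)⁻¹ * ι (a j) = 1 := by rw [← map_mul, inv_mul_cancel₀ hj, map_one]
    have h2 : g i = ι (a j)⁻¹ * ((ι (a j) * g i - ι (a i) * g j) + ι (a i) * g j) := by
      rw [sub_add_cancel, ← mul_assoc, h1, one_mul]
    rw [SetLike.mem_coe, h2]
    exact Ideal.mul_mem_left _ _ (add_mem (Ideal.mem_sup_left (hmem i))
      (Ideal.mem_sup_right (Ideal.mul_mem_left _ _ (Ideal.mem_span_singleton_self _))))
  have hpow : g j ^ (E + 1) ∈ J' * J ^ E ⊔ J ^ (E + 1 + 1) := by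
    have h1 := hG.aeval_sub_aeval_mem (J' := J') (J := J)
      (u := fun i ↦ ι (a j) * g i) (v := fun i ↦ g j * ι (a i))
      (fun i ↦ Ideal.mul_mem_left _ _ (hgJ _)) (fun i ↦ Ideal.mul_mem_right _ _ (hgJ _))
      (fun i ↦ by rw [mul_comm (g j)]; exact hmem i)
    rw [hG.aeval_mul, hG.aeval_mul, Nat.add_sub_cancel] at h1
    have h2 : aeval (fun i ↦ ι (a i)) G = ι (eval a G) := by
      rw [← coe_aeval_eq_eval]
      exact aeval_algebraMap_apply R a G
    rw [h2] at h1
    have h3 : g j ^ (E + 1) * ι (eval a G) ∈ J' * J ^ E ⊔ J ^ (E + 1 + 1) := by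
      rw [← sub_sub_cancel (ι (a j) ^ (E + 1) * aeval g G) (g j ^ (E + 1) * ι (eval a G))]
      exact sub_mem (Ideal.mem_sup_right (Ideal.mul_mem_left _ _ hGg)) (Ideal.mem_sup_left h1)
    exact (Ideal.mul_unit_mem_iff_mem _ ((isUnit_iff_ne_zero.2 ha).map ι)).1 h3
  have hle : J ^ (E + 1) ≤ J' * J ^ E ⊔ J • J ^ (E + 1) := by
    have hJeq : J = J' ⊔ Ideal.span {g j} :=
      le_antisymm hJle (sup_le hJ'J ((Ideal.span_singleton_le_iff_mem _).2 (hgJ j)))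
    have h1 := Ideal.sup_pow_le_mul_sup_pow_sup_pow J' (Ideal.span {g j}) E
    rw [← hJeq] at h1
    refine h1.trans (sup_le le_sup_left ?_)
    rw [Ideal.span_singleton_pow, Ideal.span_singleton_le_iff_mem, smul_eq_mul, ← pow_succ']
    exact hpow
  obtain ⟨s, hs, hsle⟩ := Submodule.exists_sub_one_mem_and_smul_le_of_fg_of_le_sup
    (IsNoetherian.noetherian (J ^ (E + 1))) le_rfl hle
  refine ⟨g', hJ'J, s, hs, E, ?_⟩
  rw [← smul_eq_mul, Submodule.ideal_span_singleton_smul]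
  exact hsle

theorem Ideal.exists_isReductionNear_span_range {K σ : Type*} [Field K] [Infinite K] [Fintype σ]
    (b : Ideal (MvPolynomial σ K)) :
    ∃ g : Fin (Fintype.card σ) → MvPolynomial σ K,
      (Ideal.span (Set.range g)).IsReductionNear b := by
  suffices ∀ (r : ℕ) (g : Fin (Fintype.card σ + r) → MvPolynomial σ K),
      ∃ g' : Fin (Fintype.card σ) → MvPolynomial σ K,
        (Ideal.span (Set.range g')).IsReductionNear (Ideal.span (Set.range g)) by
    obtain ⟨r, g, hg⟩ := Submodule.fg_iff_exists_fin_generating_family.1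
      (IsNoetherian.noetherian b)
    obtain ⟨g', hg'⟩ := this r (Fin.append 0 g)
    have hb : Ideal.span (Set.range (Fin.append (0 : Fin (Fintype.card σ) → _) g)) = b := by
      refine le_antisymm (Ideal.span_le.2 ?_) ?_
      · rintro _ ⟨i, rfl⟩
        refine Fin.addCases (fun i ↦ ?_) (fun i ↦ ?_) i
        · simp
        · rw [Fin.append_right, ← hg]
          exact Submodule.subset_span ⟨i, rfl⟩
      · rw [← hg]
        refine Submodule.span_mono ?_
        rintro _ ⟨i, rfl⟩
        exact ⟨Fin.natAdd _ i, Fin.append_right _ _ _⟩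
    rw [hb] at hg'
    exact ⟨g', hg'⟩
  intro r
  induction r with
  | zero => exact fun g ↦ ⟨g, Ideal.IsReductionNear.refl _⟩
  | succ r ih =>
    intro g
    obtain ⟨g₁, hg₁⟩ :=
      Ideal.exists_isReductionNear_of_not_algebraicIndependent (K := K) g fun hind ↦ by
        have h := hind.lift_cardinalMk_le_trdeg
        rw [trdeg_of_isDomain] at h
        simp only [Cardinal.mk_fintype, Fintype.card_fin, Cardinal.lift_natCast,
          Nat.cast_le] at h
        change Fintype.card σ + r + 1 ≤ Fintype.card σ at h
        omega
    obtain ⟨g₂, hg₂⟩ := ih g₁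
    exact ⟨g₂, hg₂.trans hg₁⟩

end NumberOfGenerators

section PrimeCharacteristic

open MvPolynomial

theorem IsIntegralOverIdeal.mul_pow_mem {R : Type*} [CommRing R] {I : Ideal R} {h : R}
    (hh : IsIntegralOverIdeal I h) :
    ∃ d : ℕ, ∀ u ∈ I, ∀ N : ℕ, u ^ d * h ^ N ∈ I ^ N := by
  obtain ⟨d, hd, c, hc, heq⟩ := hh
  refine ⟨d, fun u hu N ↦ ?_⟩
  induction N using Nat.strong_induction_on with
  | _ N ih =>
    rcases lt_or_ge N d with hlt | hge
    · exact Ideal.mul_mem_right _ _ (Ideal.pow_le_pow_right hlt.le (Ideal.pow_mem_pow hu d))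
    · have h1 : u ^ d * h ^ N =
          -∑ i ∈ Finset.Icc 1 d, c i * (u ^ d * h ^ (N - i)) := by
        have h2 : h ^ N = h ^ d * h ^ (N - d) := by rw [← pow_add, Nat.add_sub_cancel' hge]
        rw [h2, eq_neg_of_add_eq_zero_left heq, neg_mul, mul_neg, Finset.sum_mul, Finset.mul_sum]
        congr 1
        refine Finset.sum_congr rfl fun i hi ↦ ?_
        have hi' := Finset.mem_Icc.1 hi
        have h3 : N - i = d - i + (N - d) := by omega
        rw [h3, pow_add]
        ring
      rw [h1]
      refine neg_mem (Ideal.sum_mem _ fun i hi ↦ ?_)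
      have hi' := Finset.mem_Icc.1 hi
      have h4 := Ideal.mul_mem_mul (hc i hi) (ih (N - i) (by omega))
      rwa [← pow_add, Nat.add_sub_cancel' (by omega)] at h4

theorem Ideal.span_range_pow_le_span_pow {R ι : Type*} [CommRing R] [Fintype ι] (g : ι → R)
    {n m : ℕ} (hι : Fintype.card ι ≤ n) (hn : 1 ≤ n) (hm : n ≤ m) {q : ℕ} (hq : 0 < q) :
    Ideal.span (Set.range g) ^ (m * q) ≤
      Ideal.span ((fun w ↦ w ^ q) '' (Ideal.span (Set.range g) ^ (m + 1 - n) : Ideal R)) := by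
  intro x hx
  obtain ⟨G, hG, rfl⟩ := (Ideal.mem_span_pow_iff_exists_isHomogeneous g x).1 hx
  rw [← aeval_eq_eval, aeval_eq_sum_toMultiset]
  refine Ideal.sum_mem _ fun α hα ↦ Ideal.mul_mem_left _ _ ?_
  have hcard := hG.card_toMultiset hα
  have hgmem : ∀ β : ι → ℕ, ∏ i, g i ^ β i ∈ Ideal.span (Set.range g) ^ ∑ i, β i := by
    intro β
    rw [← Finset.prod_pow_eq_pow_sum]
    exact Ideal.prod_mem_prod fun i _ ↦ Ideal.pow_mem_pow
      (Ideal.subset_span (Set.mem_range_self i)) _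
  have hprod : ((Finsupp.toMultiset α).map g).prod =
      (∏ i, g i ^ (α i % q)) * (∏ i, g i ^ (α i / q)) ^ q := by
    classical
    rw [Finset.prod_multiset_map_count, Finsupp.toFinset_toMultiset, ← Finset.prod_pow,
      ← Finset.prod_mul_distrib, Finset.prod_subset (Finset.subset_univ _)]
    · refine Finset.prod_congr rfl fun i _ ↦ ?_
      rw [← pow_mul, ← pow_add, Finsupp.count_toMultiset, mul_comm, Nat.mod_add_div]
    · intro i _ hi
      rw [Finsupp.count_toMultiset, Finsupp.notMem_support_iff.1 hi, pow_zero]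
  rw [hprod]
  refine Ideal.mul_mem_left _ _ (Ideal.subset_span (Set.mem_image_of_mem (· ^ q) ?_))
  refine Ideal.pow_le_pow_right ?_ (hgmem fun i ↦ α i / q)
  have hsum : ∑ i, α i = m * q := by
    rw [← hcard, Finsupp.card_toMultiset, Finsupp.sum_fintype]
    · rfl
    · simp
  have h1 : ∑ i, α i ≤ q * ∑ i, α i / q + n * (q - 1) := by
    calc ∑ i, α i ≤ ∑ i, (q * (α i / q) + (q - 1)) := by
          refine Finset.sum_le_sum fun i _ ↦ ?_
          have := Nat.div_add_mod (α i) q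
          have := Nat.mod_lt (α i) hq
          omega
      _ = q * ∑ i, α i / q + Fintype.card ι * (q - 1) := by
          rw [Finset.sum_add_distrib, Finset.mul_sum]
          simp
      _ ≤ _ := by gcongr
  rw [hsum] at h1
  by_contra! hlt
  obtain ⟨k, rfl⟩ := Nat.exists_eq_add_of_le hm
  have h2 : ∑ i, α i / q ≤ k := by omega
  obtain ⟨q, rfl⟩ : ∃ q', q = q' + 1 := ⟨q - 1, by omega⟩
  simp only [Nat.add_sub_cancel] at h1
  nlinarith

variable {σ F : Type*} [Field F]

/-- The `F`-linear map picking out the monomials with exponents congruent to `α` modulo `q`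
and sending `x ^ (α + q • γ)` to `x ^ γ`. -/
noncomputable def MvPolynomial.contractMod (q : ℕ) (α : σ →₀ ℕ) :
    MvPolynomial σ F →ₗ[F] MvPolynomial σ F := by
  classical
  exact (basisMonomials σ F).constr F fun β ↦
    if β.mapRange (· % q) (Nat.zero_mod q) = α then
      monomial (β.mapRange (· / q) (Nat.zero_div q)) 1 else 0

open Classical in
theorem MvPolynomial.contractMod_monomial (q : ℕ) (α β : σ →₀ ℕ) (a : F) :
    contractMod q α (monomial β a) =
      if β.mapRange (· % q) (Nat.zero_mod q) = α then
        monomial (β.mapRange (· / q) (Nat.zero_div q)) a else 0 := by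
  have h : (monomial β a : MvPolynomial σ F) = a • basisMonomials σ F β := by
    rw [coe_basisMonomials, smul_monomial, smul_eq_mul, mul_one]
  rw [h, map_smul, contractMod, Module.Basis.constr_basis]
  split_ifs <;> simp [smul_monomial]

theorem MvPolynomial.contractMod_expand_mul {q : ℕ} (hq : 0 < q) (α : σ →₀ ℕ)
    (w v : MvPolynomial σ F) :
    contractMod q α (expand q w * v) = w * contractMod q α v := by
  classical
  induction w using MvPolynomial.induction_on' with
  | add w₁ w₂ h₁ h₂ => rw [map_add, add_mul, map_add, h₁, h₂, add_mul]
  | monomial δ a =>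
    induction v using MvPolynomial.induction_on' with
    | add v₁ v₂ h₁ h₂ => rw [mul_add, map_add, h₁, h₂, map_add, mul_add]
    | monomial β b =>
      rw [expand_monomial, monomial_mul, contractMod_monomial, contractMod_monomial]
      have h1 : (q • δ + β).mapRange (· % q) (Nat.zero_mod q) =
          β.mapRange (· % q) (Nat.zero_mod q) := by
        ext i
        simp
      have h2 : (q • δ + β).mapRange (· / q) (Nat.zero_div q) =
          δ + β.mapRange (· / q) (Nat.zero_div q) := by
        ext i
        simp [Nat.mul_add_div hq]
      rw [h1, h2, mul_ite, mul_zero, monomial_mul]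

theorem MvPolynomial.contractMod_eq_C {q : ℕ} {c : MvPolynomial σ F} (hq : c.totalDegree < q)
    {α : σ →₀ ℕ} (hα : α ∈ c.support) : contractMod q α c = C (c.coeff α) := by
  classical
  conv_lhs => rw [c.as_sum]
  rw [map_sum, Finset.sum_eq_single α]
  · have hlt : ∀ i, α i < q := fun i ↦
      (Finsupp.le_degree i α).trans_lt ((le_totalDegree hα).trans_lt hq)
    rw [contractMod_monomial, if_pos, C_apply]
    · have h0 : α.mapRange (· / q) (Nat.zero_div q) = 0 := by
        ext i
        simp [Nat.div_eq_of_lt (hlt i)]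
      rw [h0]
    · ext i
      simp [Nat.mod_eq_of_lt (hlt i)]
  · intro β hβ hne
    have hlt : ∀ i, β i < q := fun i ↦
      (Finsupp.le_degree i β).trans_lt ((le_totalDegree hβ).trans_lt hq)
    rw [contractMod_monomial, if_neg]
    intro h
    apply hne
    rw [← h]
    ext i
    simp [Nat.mod_eq_of_lt (hlt i)]
  · exact fun h ↦ absurd hα h

/-- Ideals of polynomial rings over perfect fields are tightly closed. -/
theorem MvPolynomial.mem_of_forall_mul_pow_mem_span (p : ℕ) [Fact p.Prime] [CharP F p]
    [PerfectRing F p] {I : Ideal (MvPolynomial σ F)} {c h : MvPolynomial σ F} (hc : c ≠ 0)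
    (H : ∀ e : ℕ, c * h ^ p ^ e ∈ Ideal.span ((fun w ↦ w ^ p ^ e) '' (I : Set _))) : h ∈ I := by
  have hp : 1 < p := (Fact.out : p.Prime).one_lt
  obtain ⟨e, he⟩ : ∃ e, c.totalDegree < p ^ e := ⟨_, Nat.lt_pow_self hp⟩
  have hq : 0 < p ^ e := (Nat.zero_le _).trans_lt he
  obtain ⟨α, hα⟩ : c.support.Nonempty := support_nonempty.2 hc
  let L : MvPolynomial σ F →+* MvPolynomial σ F := map (iterateFrobenius F p e)
  have hL : ∀ w, w ^ p ^ e = expand (p ^ e) (L w) := fun w ↦ by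
    rw [← map_iterateFrobenius_expand, map_expand]
  have hspan : ∀ x ∈ Ideal.span ((fun w ↦ w ^ p ^ e) '' (I : Set (MvPolynomial σ F))),
      contractMod (p ^ e) α x ∈ I.map L := by
    intro x hx
    induction hx using Submodule.closure_induction with
    | zero => rw [map_zero]; exact zero_mem _
    | add x y _ _ hx hy => rw [map_add]; exact add_mem hx hy
    | smul_mem r x hx =>
      obtain ⟨w, hw, rfl⟩ := hx
      simp only [smul_eq_mul]
      rw [hL, mul_comm, contractMod_expand_mul hq]
      exact Ideal.mul_mem_right _ _ (Ideal.mem_map_of_mem L hw)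
  have h1 := hspan _ (H e)
  rw [hL, mul_comm, contractMod_expand_mul hq, contractMod_eq_C he hα] at h1
  have hunit : IsUnit (C (c.coeff α) : MvPolynomial σ F) :=
    (isUnit_iff_ne_zero.2 (mem_support_iff.1 hα)).map C
  rw [Ideal.mul_unit_mem_iff_mem _ hunit] at h1
  let L' : MvPolynomial σ F →+* MvPolynomial σ F :=
    map ((iterateFrobeniusEquiv F p e).symm : F →+* F)
  have hLL : L'.comp L = RingHom.id _ := by
    refine MvPolynomial.ringHom_ext (fun a ↦ ?_) fun i ↦ ?_
    · rw [RingHom.comp_apply, map_C, map_C, ← coe_iterateFrobeniusEquiv]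
      exact congrArg C ((iterateFrobeniusEquiv F p e).symm_apply_apply a)
    · simp [L, L']
  have h2 := Ideal.mem_map_of_mem L' h1
  rw [Ideal.map_map, hLL, Ideal.map_id, ← RingHom.comp_apply, hLL] at h2
  exact h2

theorem MvPolynomial.mem_pow_of_isIntegralOverIdeal_of_charP (p : ℕ) [Fact p.Prime] [CharP F p]
    [PerfectRing F p] {ι : Type*} [Fintype ι] (g : ι → MvPolynomial σ F) {n m : ℕ}
    (hι : Fintype.card ι ≤ n) (hn : 1 ≤ n) (hm : n ≤ m) {h : MvPolynomial σ F}
    (hh : IsIntegralOverIdeal (Ideal.span (Set.range g) ^ m) h) :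
    h ∈ Ideal.span (Set.range g) ^ (m + 1 - n) := by
  set J := Ideal.span (Set.range g) with hJ
  by_cases hJ0 : J = ⊥
  · obtain ⟨d, hd, c, hc, heq⟩ := hh
    have hm0 : m ≠ 0 := by omega
    have hz : h ^ d = 0 := by
      rw [← heq, left_eq_add]
      refine Finset.sum_eq_zero fun i hi ↦ ?_
      have hci := hc i hi
      have hi0 : i ≠ 0 := by
        have := Finset.mem_Icc.1 hi
        omega
      rw [hJ0, ← Ideal.zero_eq_bot, zero_pow hm0, zero_pow hi0, Ideal.zero_eq_bot,
        Ideal.mem_bot] at hci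
      rw [hci, zero_mul]
    rw [pow_eq_zero_iff hd.ne'] at hz
    rw [hz]
    exact zero_mem _
  · obtain ⟨u, hu, hu0⟩ := Submodule.exists_mem_ne_zero_of_ne_bot hJ0
    obtain ⟨d, hd⟩ := hh.mul_pow_mem
    refine mem_of_forall_mul_pow_mem_span p (pow_ne_zero d (pow_ne_zero m hu0)) fun e ↦ ?_
    have h1 := hd _ (Ideal.pow_mem_pow hu m) (p ^ e)
    rw [← pow_mul] at h1
    exact Ideal.span_range_pow_le_span_pow g hι hn hm
      (pow_pos (Fact.out : p.Prime).pos e) h1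

end PrimeCharacteristic

section ReductionModP

open MvPolynomial

theorem Int.isJacobsonRing : IsJacobsonRing ℤ := by
  rw [isJacobsonRing_iff_prime_eq]
  intro P hP
  by_cases h0 : P = ⊥
  · subst h0
    refine le_antisymm (fun x hx ↦ ?_) Ideal.le_jacobson
    rw [Ideal.mem_jacobson_bot] at hx
    have h1 := Int.isUnit_iff.1 (hx 2)
    have h2 := Int.isUnit_iff.1 (hx (-2))
    rw [Ideal.mem_bot]
    omega
  · have := hP.isMaximal h0
    exact Ideal.jacobson_eq_self_of_isMaximal

theorem exists_ringHom_isAlgClosed_charP.{u} (A : Type u) [CommRing A] [Nontrivial A]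
    [Algebra.FiniteType ℤ A] :
    ∃ (p : ℕ) (F : Type u) (_ : Field F) (_ : IsAlgClosed F) (_ : CharP F p) (_ : A →+* F),
      p.Prime := by
  obtain ⟨Q, hQ⟩ := Ideal.exists_maximal A
  let _ := Ideal.Quotient.field Q
  have := Int.isJacobsonRing
  have hfin : Module.Finite ℤ (A ⧸ Q) := finite_of_finite_type_of_isJacobsonRing ℤ (A ⧸ Q)
  obtain ⟨p, hp⟩ := CharP.exists (A ⧸ Q)
  refine ⟨p, AlgebraicClosure (A ⧸ Q), inferInstance, inferInstance,
    charP_of_injective_algebraMap (algebraMap (A ⧸ Q) (AlgebraicClosure (A ⧸ Q))).injective p,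
    (algebraMap (A ⧸ Q) (AlgebraicClosure (A ⧸ Q))).comp (Ideal.Quotient.mk Q), ?_⟩
  refine (CharP.char_is_prime_or_zero (A ⧸ Q) p).resolve_right fun h0 ↦ ?_
  subst h0
  have := CharP.charP_to_charZero (A ⧸ Q)
  exact Int.not_isField (isField_of_isIntegral_of_isField
    (algebraMap ℤ (A ⧸ Q)).injective_int (Field.toIsField (A ⧸ Q)))

theorem MvPolynomial.exists_finiteType_subset_range_map {σ K : Type*} [CommRing K]
    {T : Set (MvPolynomial σ K)} (hT : T.Finite) :
    ∃ A : Subalgebra ℤ K, Algebra.FiniteType ℤ A ∧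
      T ⊆ Set.range (map (σ := σ) (algebraMap A K)) := by
  have hfin : (⋃ P ∈ T, (P.coeffs : Set K)).Finite := hT.biUnion fun P _ ↦ P.coeffs.finite_toSet
  refine ⟨Algebra.adjoin ℤ (⋃ P ∈ T, (P.coeffs : Set K)), ?_, fun P hP ↦ ?_⟩
  · rw [← Subalgebra.fg_iff_finiteType]
    exact Subalgebra.fg_def.2 ⟨_, hfin, rfl⟩
  · rw [mem_range_map_iff_coeffs_subset]
    intro x hx
    exact ⟨⟨x, Algebra.subset_adjoin (Set.mem_biUnion hP hx)⟩, rfl⟩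

theorem Ideal.span_range_pow_eq {R ι : Type*} [CommRing R] (g : ι → R) (k : ℕ) :
    Ideal.span (Set.range g) ^ k =
      Ideal.span (Set.range fun τ : Fin k → ι ↦ ∏ j, g (τ j)) := by
  induction k with
  | zero => simp
  | succ k ih =>
    rw [pow_succ', ih, Ideal.span_mul_span']
    congr 1
    ext x
    constructor
    · rintro ⟨_, ⟨i, rfl⟩, _, ⟨τ, rfl⟩, rfl⟩
      exact ⟨Fin.cons i τ, by simp [Fin.prod_univ_succ]⟩
    · rintro ⟨τ, rfl⟩
      exact ⟨_, ⟨τ 0, rfl⟩, _, ⟨Fin.tail τ, rfl⟩, by simp [Fin.prod_univ_succ, Fin.tail]⟩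

/-- The linear functional on polynomials given by finitely many weighted coefficients. -/
noncomputable def MvPolynomial.coeffSum {σ R : Type*} [CommRing R] (D : Finset (σ →₀ ℕ))
    (w : (σ →₀ ℕ) → R) : MvPolynomial σ R →ₗ[R] R :=
  ∑ α ∈ D, w α • lcoeff R α

theorem MvPolynomial.coeffSum_apply {σ R : Type*} [CommRing R] (D : Finset (σ →₀ ℕ))
    (w : (σ →₀ ℕ) → R) (P : MvPolynomial σ R) :
    coeffSum D w P = ∑ α ∈ D, w α * P.coeff α := by
  simp [coeffSum]

theorem MvPolynomial.coeffSum_map {σ R S : Type*} [CommRing R] [CommRing S] (φ : R →+* S)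
    (D : Finset (σ →₀ ℕ)) {w : (σ →₀ ℕ) → R} {w' : (σ →₀ ℕ) → S} (hw : ∀ α ∈ D, φ (w α) = w' α)
    (P : MvPolynomial σ R) : coeffSum D w' (map φ P) = φ (coeffSum D w P) := by
  rw [coeffSum_apply, coeffSum_apply, map_sum]
  refine Finset.sum_congr rfl fun α hα ↦ ?_
  rw [map_mul, hw α hα, coeff_map]

theorem MvPolynomial.coeffSum_ne_one_of_isIntegralOverIdeal {σ K ι : Type*} [Field K]
    [CharZero K] [Fintype ι] (g : ι → MvPolynomial σ K) {n m : ℕ}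
    (hι : Fintype.card ι ≤ n) (hn : 1 ≤ n) (hm : n ≤ m) {h : MvPolynomial σ K}
    (hh : IsIntegralOverIdeal (Ideal.span (Set.range g) ^ m) h) (D : Finset (σ →₀ ℕ))
    (w : (σ →₀ ℕ) → K)
    (hw : ∀ P ∈ Ideal.span (Set.range g) ^ (m + 1 - n), coeffSum D w P = 0) :
    coeffSum D w h ≠ 1 := by
  intro hwh
  obtain ⟨d, hd, c, hc, heq⟩ := hh
  have hc' : ∀ i, ∃ u : (Fin (m * i) → ι) → MvPolynomial σ K, i ∈ Finset.Icc 1 d →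
      ∑ τ, u τ * ∏ j, g (τ j) = c i := by
    intro i
    by_cases hi : i ∈ Finset.Icc 1 d
    · have h1 := hc i hi
      rw [← pow_mul, Ideal.span_range_pow_eq, Ideal.mem_span_range_iff_exists_fun] at h1
      obtain ⟨u, hu⟩ := h1
      exact ⟨u, fun _ ↦ hu⟩
    · exact ⟨0, fun h ↦ absurd h hi⟩
  choose u hu using hc'
  have hfin : (Set.range g ∪ {h} ∪ (⋃ i ∈ Finset.Icc 1 d, Set.range (u i)) ∪
      (fun α ↦ C (w α)) '' (D : Set (σ →₀ ℕ))).Finite :=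
    (((Set.finite_range g).union (Set.finite_singleton h)).union
      ((Finset.Icc 1 d).finite_toSet.biUnion fun i _ ↦ Set.finite_range (u i))).union
      (D.finite_toSet.image _)
  obtain ⟨A, hA, hsub⟩ := exists_finiteType_subset_range_map hfin
  simp only [Set.union_subset_iff] at hsub
  obtain ⟨⟨⟨hg, hh⟩, hu'⟩, hw'⟩ := hsub
  choose gA hgA using fun i ↦ hg ⟨i, rfl⟩
  obtain ⟨hA', hhA⟩ := hh rfl
  have huA : ∀ i τ, ∃ v, i ∈ Finset.Icc 1 d → map (algebraMap A K) v = u i τ := by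
    intro i τ
    by_cases hi : i ∈ Finset.Icc 1 d
    · obtain ⟨v, hv⟩ := hu' (Set.mem_biUnion hi ⟨τ, rfl⟩)
      exact ⟨v, fun _ ↦ hv⟩
    · exact ⟨0, fun h ↦ absurd h hi⟩
  choose uA huA using huA
  have hwA : ∀ α, ∃ v : A, α ∈ D → algebraMap A K v = w α := by
    intro α
    by_cases hα : α ∈ D
    · obtain ⟨v, hv⟩ := hw' (Set.mem_image_of_mem _ hα)
      refine ⟨v.coeff 0, fun _ ↦ ?_⟩
      rw [← coeff_map, hv, coeff_zero_C]
    · exact ⟨0, fun h ↦ absurd h hα⟩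
  choose wA hwA using hwA
  have hinj : Function.Injective (algebraMap A K) := Subtype.val_injective
  have hinj' := map_injective (σ := σ) (algebraMap A K) hinj
  have hint : IsIntegralOverIdeal (Ideal.span (Set.range gA) ^ m) hA' := by
    refine ⟨d, hd, fun i ↦ ∑ τ, uA i τ * ∏ j, gA (τ j), fun i _ ↦ ?_, hinj' ?_⟩
    · rw [← pow_mul, Ideal.span_range_pow_eq]
      exact Ideal.mem_span_range_iff_exists_fun.2 ⟨uA i, rfl⟩
    · rw [map_zero, ← heq, map_add, map_pow, map_sum, hhA]
      congr 1
      refine Finset.sum_congr rfl fun i hi ↦ ?_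
      simp only [map_mul, map_pow, map_sum, map_prod, hhA, hgA, huA i _ hi, hu i hi]
  obtain ⟨p, F, _, _, _, φ, hp⟩ := exists_ringHom_isAlgClosed_charP A
  have : Fact p.Prime := ⟨hp⟩
  have hF := hint.map (map φ)
  have hspan : (Ideal.span (Set.range gA)).map (map φ) =
      Ideal.span (Set.range fun i ↦ map φ (gA i)) := by
    rw [Ideal.map_span, ← Set.range_comp]
    rfl
  rw [Ideal.map_pow, hspan] at hF
  have hmem := mem_pow_of_isIntegralOverIdeal_of_charP p _ hι hn hm hF
  have hvan : ∀ P ∈ Ideal.span (Set.range fun i ↦ map φ (gA i)) ^ (m + 1 - n),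
      coeffSum D (fun α ↦ φ (wA α)) P = 0 := by
    intro P hP
    rw [Ideal.span_range_pow_eq] at hP
    induction hP using Submodule.closure_induction with
    | zero => rw [map_zero]
    | add x y _ _ hx hy => rw [map_add, hx, hy, add_zero]
    | smul_mem r x hx =>
      obtain ⟨τ, rfl⟩ := hx
      rw [smul_eq_mul]
      induction r using MvPolynomial.induction_on' with
      | add r₁ r₂ h₁ h₂ => rw [add_mul, map_add, h₁, h₂, add_zero]
      | monomial β a =>
        have h1 : (monomial β a : MvPolynomial σ F) * ∏ j, map φ (gA (τ j)) =
            a • map φ (monomial β 1 * ∏ j, gA (τ j)) := by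
          rw [map_mul, map_monomial, map_prod, map_one, ← smul_mul_assoc, smul_monomial,
            smul_eq_mul, mul_one]
        have h2 : coeffSum D wA (monomial β 1 * ∏ j, gA (τ j)) = 0 := by
          apply hinj
          rw [← coeffSum_map (algebraMap A K) D hwA, map_zero]
          refine hw _ ?_
          rw [map_mul, map_prod]
          refine Ideal.mul_mem_left _ _ ?_
          rw [Ideal.span_range_pow_eq]
          simp only [hgA]
          exact Ideal.subset_span ⟨τ, rfl⟩
        rw [h1, map_smul, coeffSum_map φ D (fun α _ ↦ rfl), h2, map_zero, smul_zero]
  have h1 := hvan _ hmem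
  have h2 : coeffSum D wA hA' = 1 := by
    apply hinj
    rw [← coeffSum_map (algebraMap A K) D hwA, hhA, hwh, map_one]
  rw [coeffSum_map φ D (fun α _ ↦ rfl), h2, map_one] at h1
  exact one_ne_zero h1

end ReductionModP

section Localization

open MvPolynomial

theorem Ideal.exists_isMaximal_notMem_sup_pow {R : Type*} [CommRing R] [IsNoetherianRing R]
    {I : Ideal R} {h : R} (hI : h ∉ I) :
    ∃ M : Ideal R, M.IsMaximal ∧ ∃ t : ℕ, h ∉ I ⊔ M ^ t := by
  have hne : Submodule.colon I {h} ≠ ⊤ := by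
    intro htop
    have h1 : (1 : R) ∈ Submodule.colon I {h} := htop ▸ Submodule.mem_top
    rw [Submodule.mem_colon_singleton, one_smul] at h1
    exact hI h1
  obtain ⟨M, hM, hle⟩ := Ideal.exists_le_maximal _ hne
  refine ⟨M, hM, ?_⟩
  by_contra! hall
  have hx : (Submodule.Quotient.mk h : R ⧸ I) ∈
      (⨅ i, M ^ i • (⊤ : Submodule R (R ⧸ I)) : Submodule R (R ⧸ I)) := by
    rw [Submodule.mem_iInf]
    intro t
    obtain ⟨y, hy, z, hz, hyz⟩ := Submodule.mem_sup.1 (hall t)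
    have h1 : (Submodule.Quotient.mk h : R ⧸ I) = z • Submodule.Quotient.mk 1 := by
      rw [← Submodule.Quotient.mk_smul, smul_eq_mul, mul_one, ← hyz,
        Submodule.Quotient.mk_add, (Submodule.Quotient.mk_eq_zero I).2 hy, zero_add]
    rw [h1]
    exact Submodule.smul_mem_smul hz Submodule.mem_top
  obtain ⟨r, hr⟩ := (Ideal.mem_iInf_smul_pow_eq_bot_iff M _).1 hx
  rw [← Submodule.Quotient.mk_smul, Submodule.Quotient.eq] at hr
  refine hM.ne_top ((Ideal.eq_top_iff_one M).2 ?_)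
  have h1 : (r : R) - 1 ∈ M := by
    refine hle ?_
    rw [Submodule.mem_colon_singleton, sub_smul, one_smul]
    exact hr
  have h2 := sub_mem r.2 h1
  rwa [sub_sub_cancel] at h2

theorem MvPolynomial.exists_coeffSum_eq {σ K : Type*} [Field K] [Finite σ] {t : ℕ}
    (f : MvPolynomial σ K →ₗ[K] K)
    (hf : ∀ P ∈ RingHom.ker (eval (0 : σ → K)) ^ t, f P = 0) :
    ∃ (D : Finset (σ →₀ ℕ)) (w : (σ →₀ ℕ) → K), coeffSum D w = f := by
  classical
  have hfin : {α : σ →₀ ℕ | α.degree < t}.Finite :=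
    (Finsupp.finite_of_degree_le t).subset fun α (hα : α.degree < t) ↦
      show α.degree ≤ t from hα.le
  refine ⟨hfin.toFinset, fun α ↦ f (monomial α 1), ?_⟩
  refine (basisMonomials σ K).ext fun α ↦ ?_
  rw [coe_basisMonomials, coeffSum_apply]
  simp only [coeff_monomial, mul_ite, mul_one, mul_zero]
  rw [Finset.sum_ite_eq]
  split_ifs with hα
  · rfl
  · rw [Set.Finite.mem_toFinset, Set.mem_ofPred_eq, not_lt] at hα
    refine (hf _ (Ideal.pow_le_pow_right hα ?_)).symm
    rw [monomial_eq, C_1, one_mul, Finsupp.degree_apply, Finsupp.prod,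
      ← Finset.prod_pow_eq_pow_sum]
    exact Ideal.prod_mem_prod fun i _ ↦ Ideal.pow_mem_pow (by simp [RingHom.mem_ker]) _

theorem MvPolynomial.mem_pow_of_isIntegralOverIdeal {σ K ι : Type*} [Field K] [IsAlgClosed K]
    [CharZero K] [Finite σ] [Fintype ι] (g : ι → MvPolynomial σ K) {n m : ℕ}
    (hι : Fintype.card ι ≤ n) (hn : 1 ≤ n) (hm : n ≤ m) {h : MvPolynomial σ K}
    (hh : IsIntegralOverIdeal (Ideal.span (Set.range g) ^ m) h) :
    h ∈ Ideal.span (Set.range g) ^ (m + 1 - n) := by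
  by_contra hnot
  obtain ⟨M, hM, t, ht⟩ := Ideal.exists_isMaximal_notMem_sup_pow hnot
  obtain ⟨a, rfl⟩ := isMaximal_iff_eq_vanishingIdeal_singleton.1 hM
  let e : MvPolynomial σ K →+* MvPolynomial σ K := (aeval fun i ↦ X i + C (a i)).toRingHom
  let e' : MvPolynomial σ K →+* MvPolynomial σ K := (aeval fun i ↦ X i - C (a i)).toRingHom
  have hee : e'.comp e = RingHom.id _ := by
    refine MvPolynomial.ringHom_ext (fun b ↦ ?_) fun i ↦ ?_
    · simp [e, e']
    · simp [e, e']
  have heval : (eval a).comp e' = eval (0 : σ → K) := by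
    refine MvPolynomial.ringHom_ext (fun b ↦ ?_) fun i ↦ ?_
    · simp [e']
    · simp [e']
  set M₀ : Ideal (MvPolynomial σ K) := RingHom.ker (eval (0 : σ → K))
  set I := Ideal.span (Set.range g) ^ (m + 1 - n) with hI
  have hnot' : e h ∉ I.map e ⊔ M₀ ^ t := by
    intro hcon
    have h1 := Ideal.mem_map_of_mem e' hcon
    rw [← RingHom.comp_apply, Ideal.map_sup, Ideal.map_map, hee, Ideal.map_id,
      Ideal.map_pow] at h1
    have hle : M₀.map e' ≤ vanishingIdeal K {a} := by
      rw [Ideal.map_le_iff_le_comap]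
      intro P hP
      rw [Ideal.mem_comap, mem_vanishingIdeal_singleton_iff, aeval_eq_eval]
      change ((eval a).comp e') P = 0
      rw [heval]
      exact hP
    have hle' : I ⊔ M₀.map e' ^ t ≤ I ⊔ vanishingIdeal K {a} ^ t :=
      sup_le_sup le_rfl (Ideal.pow_right_mono hle t)
    exact ht (hle' h1)
  obtain ⟨f, hfh, hf⟩ := Submodule.exists_le_ker_of_notMem
    (p := (I.map e ⊔ M₀ ^ t).restrictScalars K) hnot'
  obtain ⟨D, w, hDw⟩ := exists_coeffSum_eq ((f (e h))⁻¹ • f) (t := t) fun P hP ↦ by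
    have : f P = 0 := hf (Ideal.mem_sup_right hP)
    rw [LinearMap.smul_apply, this, smul_zero]
  have hint := hh.map e
  have hspan : (Ideal.span (Set.range g)).map e = Ideal.span (Set.range fun i ↦ e (g i)) := by
    rw [Ideal.map_span, ← Set.range_comp]
    rfl
  rw [Ideal.map_pow, hspan] at hint
  refine coeffSum_ne_one_of_isIntegralOverIdeal _ hι hn hm hint D w (fun P hP ↦ ?_) ?_
  · rw [← hspan, ← Ideal.map_pow] at hP
    have : f P = 0 := hf (Ideal.mem_sup_left hP)
    rw [hDw, LinearMap.smul_apply, this, smul_zero]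
  · rw [hDw, LinearMap.smul_apply, smul_eq_mul, inv_mul_cancel₀ hfh]

end Localization

/-- (Briançon–Skoda) For a nonzero ideal `𝔟 ⊆ k[x_1,…,x_n]` over an algebraically closed
field of characteristic zero and any `m ≥ n`, the integral closure of `𝔟^m` is contained
in `𝔟^{m+1-n}`. -/
theorem brianconSkoda {k : Type*} [Field k] [IsAlgClosed k] [CharZero k] {n : ℕ}
    (b : Ideal (MvPolynomial (Fin n) k)) (hb : b ≠ ⊥) (m : ℕ) (hm : n ≤ m) :
    ∀ f : MvPolynomial (Fin n) k, IsIntegralOverIdeal (b ^ m) f → f ∈ b ^ (m + 1 - n) := by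
  intro f hf
  rcases Nat.eq_zero_or_pos n with rfl | hn
  · obtain ⟨u, hu, hu0⟩ := Submodule.exists_mem_ne_zero_of_ne_bot hb
    rw [MvPolynomial.eq_C_of_isEmpty u] at hu hu0
    have hunit : IsUnit (u.coeff 0) := isUnit_iff_ne_zero.2 fun h ↦ hu0 (by rw [h, map_zero])
    rw [Ideal.eq_top_of_isUnit_mem b hu (hunit.map MvPolynomial.C), Ideal.top_pow]
    trivial
  · obtain ⟨g, hg⟩ := Ideal.exists_isReductionNear_span_range b
    obtain ⟨s, hs, hsf⟩ := hg.exists_isIntegralOverIdeal hb hf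
    exact Ideal.mem_pow_of_mul_mem_pow hs (Ideal.pow_right_mono hg.1 _
      (MvPolynomial.mem_pow_of_isIntegralOverIdeal g (by simp) hn hm hsf))
end

section
/- Let k be an algebraically closed field of characteristic zero and f ∈ k[x_1, …, x_n] a nonconstant polynomial whose zero hypersurface is singular at exactly one point x ∈ k^n (i.e. f and all its partial derivatives vanish at x, and at every other zero of f some partial derivative is nonzero). Then the Tjurina number τ = dim_k 𝒪_x / (f, ∂f/∂x_1, …, ∂f/∂x_n)·𝒪_x is finite, where 𝒪_x denotes the localization of k[x_1,…,x_n] at the maximal ideal of the point x, and n·(τ + 1) is a uniform Artin–Rees number for f: for every ideal 𝔟 ⊆ k[x_1,…,x_n] and every m ≥ n·(τ+1), 𝔟^m ∩ (f) ⊆ 𝔟^{m−n(τ+1)}·(f). -/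
open MvPolynomial

/-- The polynomials over `R` whose `j`-th coefficient lies in `B ^ (m - j)`. -/
def weightedIdeal {R : Type*} [CommRing R] (B : Ideal R) (m : ℕ) : Ideal (Polynomial R) where
  carrier := {Q | ∀ j, Q.coeff j ∈ B ^ (m - j)}
  add_mem' hP hQ j := by
    rw [Polynomial.coeff_add]
    exact add_mem (hP j) (hQ j)
  zero_mem' j := by simp
  smul_mem' c Q hQ j := by
    rw [smul_eq_mul, Polynomial.coeff_mul]
    refine sum_mem fun a ha => Ideal.mul_mem_left _ _ (Ideal.pow_le_pow_right ?_ (hQ a.2))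
    have := Finset.HasAntidiagonal.mem_antidiagonal.1 ha
    omega

theorem mul_mem_weightedIdeal {R : Type*} [CommRing R] {B : Ideal R} {m l : ℕ}
    {P Q : Polynomial R} (hP : P ∈ weightedIdeal B m) (hQ : Q ∈ weightedIdeal B l) :
    P * Q ∈ weightedIdeal B (m + l) := by
  intro j
  rw [Polynomial.coeff_mul]
  refine sum_mem fun a ha => Ideal.pow_le_pow_right ?_
    ((pow_add B (m - a.1) (l - a.2)).symm ▸ Ideal.mul_mem_mul (hP a.1) (hQ a.2))
  have := Finset.HasAntidiagonal.mem_antidiagonal.1 ha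
  omega

theorem pow_mem_weightedIdeal {R : Type*} [CommRing R] {B : Ideal R} {m : ℕ}
    {P : Polynomial R} (hP : P ∈ weightedIdeal B m) (l : ℕ) :
    P ^ l ∈ weightedIdeal B (m * l) := by
  induction l with
  | zero => intro j; simp
  | succ l ih => rw [pow_succ, mul_add, mul_one]; exact mul_mem_weightedIdeal ih hP

/-- The Taylor expansion `h ↦ h(x + t eᵢ)` in the direction of the variable `i`. -/
noncomputable def taylorShift {σ K : Type*} [DecidableEq σ] [CommRing K] (i : σ) :
    MvPolynomial σ K →ₐ[K] Polynomial (MvPolynomial σ K) :=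
  aeval fun j => Polynomial.C (X j) + if j = i then Polynomial.X else 0

section Taylor

variable {σ K : Type*} [DecidableEq σ] [CommRing K]

theorem coeff_zero_taylorShift (i : σ) (h : MvPolynomial σ K) :
    (taylorShift i h).coeff 0 = h := by
  induction h using MvPolynomial.induction_on with
  | C a =>
    rw [taylorShift, aeval_C]
    simp [Polynomial.algebraMap_apply, MvPolynomial.algebraMap_eq]
  | add p q hp hq => rw [map_add, Polynomial.coeff_add, hp, hq]
  | mul_X p j hp =>
    rw [map_mul, Polynomial.mul_coeff_zero, hp, taylorShift, aeval_X]
    by_cases hj : j = i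
    · subst hj; simp
    · simp [hj]

theorem derivative_taylorShift (i : σ) (h : MvPolynomial σ K) :
    Polynomial.derivative (taylorShift i h) = taylorShift i (pderiv i h) := by
  induction h using MvPolynomial.induction_on with
  | C a =>
    rw [pderiv_C, map_zero, taylorShift, aeval_C, Polynomial.algebraMap_apply,
      Polynomial.derivative_C]
  | add p q hp hq => simp only [map_add, hp, hq]
  | mul_X p j hp =>
    have hX : Polynomial.derivative (taylorShift i (X j : MvPolynomial σ K)) =
        taylorShift i (pderiv i (X j)) := by
      rw [taylorShift, aeval_X, pderiv_X]
      by_cases hj : j = i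
      · subst hj; simp
      · simp [hj]
    rw [map_mul, Polynomial.derivative_mul, hp, hX, Derivation.leibniz, map_add, smul_eq_mul,
      smul_eq_mul, map_mul, map_mul]
    ring

theorem coeff_one_taylorShift (i : σ) (h : MvPolynomial σ K) :
    (taylorShift i h).coeff 1 = pderiv i h := by
  rw [← coeff_zero_taylorShift i (pderiv i h), ← derivative_taylorShift,
    Polynomial.coeff_derivative]
  simp

theorem taylorShift_mem_weightedIdeal (i : σ) {B : Ideal (MvPolynomial σ K)} {m : ℕ}
    {h : MvPolynomial σ K} (hh : h ∈ B ^ m) : taylorShift i h ∈ weightedIdeal B m := by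
  induction hh using Submodule.pow_induction_on_left' with
  | algebraMap r => intro j; simp
  | add x y m _ _ hx hy => rw [map_add]; exact add_mem hx hy
  | mem_mul b hb m x _ hx =>
    rw [map_mul, Nat.succ_eq_one_add]
    refine mul_mem_weightedIdeal (fun j => ?_) hx
    rcases j with _ | j
    · simpa [coeff_zero_taylorShift] using hb
    · simp

end Taylor

theorem coeff_pow_mul_derivative {R : Type*} [CommRing R] (F : Polynomial R) (N : ℕ) :
    (F ^ N * Polynomial.derivative F).coeff N = (F ^ (N + 1)).coeff (N + 1) := by
  have key (G : Polynomial (MvPolynomial R ℤ)) :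
      (G ^ N * Polynomial.derivative G).coeff N = (G ^ (N + 1)).coeff (N + 1) := by
    have h0 : ((N : MvPolynomial R ℤ) + 1) ≠ 0 := by exact_mod_cast N.succ_ne_zero
    have h : (G ^ (N + 1)).coeff (N + 1) * ((N : MvPolynomial R ℤ) + 1) =
        (G ^ N * Polynomial.derivative G).coeff N * ((N : MvPolynomial R ℤ) + 1) := by
      rw [← Polynomial.coeff_derivative, Polynomial.derivative_pow_succ, mul_assoc,
        Polynomial.coeff_C_mul, mul_comm]
    exact (mul_right_cancel₀ h0 h).symm
  obtain ⟨G, rfl⟩ := Polynomial.map_surjective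
    (aeval (R := ℤ) (id : R → R)).toRingHom (fun r => ⟨X r, by simp⟩) F
  simpa only [← Polynomial.map_pow, Polynomial.derivative_map, ← Polynomial.map_mul,
    Polynomial.coeff_map] using congrArg _ (key G)

theorem Polynomial.pow_expChar_eq {R : Type*} [CommRing R] (p : ℕ) [Fact p.Prime] [CharP R p]
    (G : Polynomial R) (e : ℕ) :
    G ^ p ^ e = Polynomial.C (G.coeff 0 ^ p ^ e) + Polynomial.X ^ p ^ e * G.divX ^ p ^ e := by
  conv_lhs => rw [← G.divX_mul_X_add]
  rw [add_pow_char_pow, mul_pow, ← Polynomial.C_pow]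
  ring

/-- If `f * g ∈ B ^ m`, then `g * ∂f` is, up to a bounded error, integral over `B ^ (m - 1)`. -/
theorem pow_mul_pderiv_mem {σ K : Type*} [DecidableEq σ] [CommRing K] (p : ℕ) [Fact p.Prime]
    [CharP K p] (i : σ) {B : Ideal (MvPolynomial σ K)} {m : ℕ} {f g : MvPolynomial σ K}
    (h : f * g ∈ B ^ m) (e : ℕ) :
    (g * pderiv i f) ^ p ^ e ∈ B ^ ((m - 1) * (p ^ e - 1)) := by
  obtain ⟨N, hN⟩ : ∃ N, p ^ e = N + 1 :=
    Nat.exists_eq_succ_of_ne_zero (pow_ne_zero _ (Fact.out : p.Prime).ne_zero)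
  set F := taylorShift i f with hF
  set G := taylorShift i g with hG
  have h1 : (F ^ (N + 1)).coeff (N + 1) = pderiv i f ^ (N + 1) := by
    rw [← hN, Polynomial.pow_expChar_eq, Polynomial.coeff_add, Polynomial.coeff_C,
      if_neg (pow_ne_zero _ (Fact.out : p.Prime).ne_zero), Polynomial.coeff_X_pow_mul', if_pos le_rfl, Nat.sub_self,
      Polynomial.coeff_zero_eq_eval_zero, Polynomial.eval_pow,
      ← Polynomial.coeff_zero_eq_eval_zero, Polynomial.coeff_divX, hF, coeff_one_taylorShift]
    simp
  have h2 : (G ^ (N + 1) * (F ^ N * Polynomial.derivative F)).coeff N =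
      (g * pderiv i f) ^ (N + 1) := by
    rw [mul_pow, ← h1, ← coeff_pow_mul_derivative, ← hN, Polynomial.pow_expChar_eq, add_mul,
      Polynomial.coeff_add, Polynomial.coeff_C_mul, mul_assoc, Polynomial.coeff_X_pow_mul',
      if_neg (by omega), add_zero, hG, coeff_zero_taylorShift]
  have h3 : G ^ (N + 1) * (F ^ N * Polynomial.derivative F) =
      (G * Polynomial.derivative F) * (taylorShift i (f * g)) ^ N := by
    rw [map_mul]; ring
  have h4 := Ideal.mul_mem_left _ (G * Polynomial.derivative F)
    (pow_mem_weightedIdeal (taylorShift_mem_weightedIdeal i h) N) N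
  rw [← h3, h2] at h4
  rw [hN, Nat.add_sub_cancel, Nat.sub_mul, one_mul]
  exact h4

section TestElement

variable {σ K : Type*} [Field K] (p : ℕ) [Fact p.Prime] [CharP K p]

theorem exists_coeff_extraction [PerfectRing K p] (e : ℕ) (γ : σ →₀ ℕ) :
    ∃ ψ : MvPolynomial σ K →+ MvPolynomial σ K, ∀ h δ,
      (coeff δ (ψ h)) ^ p ^ e = coeff (p ^ e • δ + γ) h := by
  have hinj : Function.Injective fun δ : σ →₀ ℕ => p ^ e • δ + γ := by
    intro a b hab
    ext i
    have := DFunLike.congr_fun hab i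
    simpa [(Fact.out : p.Prime).ne_zero] using this
  refine ⟨AddMonoidHom.mk' (fun h => AddMonoidAlgebra.ofCoeff
    (Finsupp.mapRange (iterateFrobeniusEquiv K p e).symm (map_zero _)
    (Finsupp.comapDomain (fun δ : σ →₀ ℕ => p ^ e • δ + γ) (AddMonoidAlgebra.coeff h)
      hinj.injOn))) ?_, ?_⟩
  · intro a b
    ext δ
    exact map_add (iterateFrobeniusEquiv K p e).symm _ _
  · intro h δ
    exact (iterateFrobeniusEquiv K p e).apply_symm_apply (coeff (p ^ e • δ + γ) h)

theorem map_pow_mul_of_coeff_extraction {e : ℕ} {γ : σ →₀ ℕ} (hγ : ∀ i, γ i < p ^ e)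
    {ψ : MvPolynomial σ K →+ MvPolynomial σ K}
    (hψ : ∀ h δ, (coeff δ (ψ h)) ^ p ^ e = coeff (p ^ e • δ + γ) h) (u h : MvPolynomial σ K) :
    ψ (u ^ p ^ e * h) = u * ψ h := by
  induction u using MvPolynomial.induction_on' with
  | add a b ha hb => rw [add_pow_char_pow, add_mul, map_add, ha, hb, add_mul]
  | monomial β a =>
    ext δ
    apply iterateFrobenius_inj K p e
    simp only [iterateFrobenius_def]
    have hle : p ^ e • β ≤ p ^ e • δ + γ ↔ β ≤ δ := by
      refine ⟨fun hle i => ?_, fun hle => le_add_right (nsmul_le_nsmul_right hle _)⟩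
      have h1 := hle i
      simp only [Finsupp.smul_apply, Finsupp.add_apply, smul_eq_mul] at h1
      have h2 := hγ i
      by_contra! h3
      have h4 : p ^ e * (δ i + 1) ≤ p ^ e * β i := Nat.mul_le_mul_left _ h3
      rw [mul_add] at h4
      omega
    rw [hψ, monomial_pow, coeff_monomial_mul', coeff_monomial_mul']
    by_cases hβ : β ≤ δ
    · rw [if_pos (hle.2 hβ), if_pos hβ, mul_pow, hψ]
      congr 2
      obtain ⟨δ, rfl⟩ := exists_add_of_le hβ
      rw [nsmul_add, add_assoc, add_tsub_cancel_left, add_tsub_cancel_left]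
    · rw [if_neg (fun h => hβ (hle.1 h)), if_neg hβ, zero_pow]
      exact pow_ne_zero _ (Fact.out : p.Prime).ne_zero

theorem mem_of_mul_pow_mem [PerfectRing K p] {e : ℕ} {d u : MvPolynomial σ K} (hd : d ≠ 0)
    (hde : d.totalDegree < p ^ e) {I : Ideal (MvPolynomial σ K)}
    (h : d * u ^ p ^ e ∈ I.map (iterateFrobenius (MvPolynomial σ K) p e)) : u ∈ I := by
  classical
  obtain ⟨γ, hγ⟩ := Finset.nonempty_iff_ne_empty.2 fun h => hd (support_eq_empty.1 h)
  have hlt (δ) (hδ : δ ∈ d.support) (i) : δ i < p ^ e :=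
    ((monomial_le_degreeOf i hδ).trans (degreeOf_le_totalDegree d i)).trans_lt hde
  obtain ⟨ψ, hψ⟩ := exists_coeff_extraction (K := K) p e γ
  have hlin := map_pow_mul_of_coeff_extraction p (hlt γ hγ) hψ
  have hI : ∀ y ∈ I.map (iterateFrobenius (MvPolynomial σ K) p e), ∀ a, ψ (y * a) ∈ I := by
    intro y hy
    induction hy using Submodule.span_induction with
    | mem y hy =>
      obtain ⟨z, hz, rfl⟩ := hy
      intro a
      rw [iterateFrobenius_def, hlin]
      exact Ideal.mul_mem_right _ _ hz
    | zero => simp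
    | add a b _ _ ha hb => intro c; rw [add_mul, map_add]; exact add_mem (ha c) (hb c)
    | smul a y _ hy => intro c; rw [smul_eq_mul, mul_comm a, mul_assoc]; exact hy _
  have hq : p ^ e ≠ 0 := pow_ne_zero _ (Fact.out : p.Prime).ne_zero
  have hψd : ψ d = C (coeff 0 (ψ d)) := by
    ext δ
    rw [coeff_C]
    split_ifs with h0
    · rw [h0]
    · obtain ⟨i, hi⟩ : ∃ i, δ i ≠ 0 := by
        by_contra! hδ
        exact h0 (Finsupp.ext fun i => (hδ i).symm)
      rw [← pow_eq_zero_iff hq, hψ, ← notMem_support_iff]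
      intro hmem
      have h1 := hlt _ hmem i
      simp only [Finsupp.smul_apply, Finsupp.add_apply, smul_eq_mul] at h1
      have := Nat.le_mul_of_pos_right (p ^ e) (Nat.pos_of_ne_zero hi)
      omega
  have hc : coeff 0 (ψ d) ≠ 0 := by
    rw [← pow_ne_zero_iff hq, hψ, smul_zero, zero_add]
    exact mem_support_iff.1 hγ
  have h1 := hI _ h 1
  rw [mul_one, mul_comm, hlin, hψd] at h1
  have h2 := Ideal.mul_mem_right (C (coeff 0 (ψ d))⁻¹) _ h1
  rwa [mul_assoc, ← C_mul, mul_inv_cancel₀ hc, C_1, mul_one] at h2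

end TestElement

theorem span_pow_add_le {R : Type*} [CommRing R] {ν : ℕ} (c : Fin (ν + 1) → R) {q E : ℕ}
    (hE : ν * (q - 1) ≤ E) :
    Ideal.span (Set.range c) ^ (q + E) ≤
      Ideal.span (Set.range fun i => c i ^ q) * Ideal.span (Set.range c) ^ E := by
  intro y hy
  obtain ⟨P, hP, rfl⟩ := (Ideal.mem_span_pow_iff_exists_isHomogeneous c y).1 hy
  rw [eval_eq']
  refine sum_mem fun β hβ => Ideal.mul_mem_left _ _ ?_
  have hdeg : ∑ i, β i = q + E := by
    have := hP (mem_support_iff.1 hβ)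
    simpa [Finsupp.weight_apply, Finsupp.sum_fintype] using this
  obtain ⟨i, hi⟩ : ∃ i, q ≤ β i := by
    by_contra! hlt
    have h1 : ∑ i, β i ≤ ∑ _i : Fin (ν + 1), (q - 1) :=
      Finset.sum_le_sum fun i _ => Nat.le_sub_one_of_lt (hlt i)
    have h2 := hlt 0
    rw [hdeg] at h1
    simp only [Finset.sum_const, Finset.card_univ, Fintype.card_fin, smul_eq_mul, add_mul,
      one_mul] at h1
    omega
  have hsplit : ∏ j, c j ^ β j = c i ^ q * ∏ j, c j ^ (β - Finsupp.single i q) j := by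
    rw [← Finset.mul_prod_erase _ _ (Finset.mem_univ i),
      ← Finset.mul_prod_erase _ (fun j => c j ^ (β - Finsupp.single i q) j) (Finset.mem_univ i),
      ← mul_assoc]
    congr 1
    · rw [← pow_add]; simp [hi]
    · refine Finset.prod_congr rfl fun j hj => ?_
      simp [Finsupp.single_eq_of_ne (Finset.ne_of_mem_erase hj)]
  rw [hsplit]
  refine Ideal.mul_mem_mul (Ideal.subset_span ⟨i, rfl⟩) ?_
  have hdeg' : ∑ j, (β - Finsupp.single i q) j = E := by
    have : ∑ j, (β - Finsupp.single i q) j + ∑ j, Finsupp.single i q j = ∑ j, β j := by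
      rw [← Finset.sum_add_distrib]
      refine Finset.sum_congr rfl fun j _ => ?_
      by_cases hj : j = i
      · subst hj; simp [hi]
      · simp [Finsupp.single_eq_of_ne hj]
    have h2 : ∑ j, Finsupp.single i q j = q := by simp [Finsupp.single_apply]
    omega
  rw [← hdeg', ← Finset.prod_pow_eq_pow_sum]
  exact Ideal.prod_mem_prod fun j _ => Ideal.pow_mem_pow (Ideal.subset_span (Set.mem_range_self j)) _

theorem span_pow_mul_add_le {R : Type*} [CommRing R] {ν : ℕ} (c : Fin (ν + 1) → R) {q E : ℕ}
    (hE : ν * (q - 1) ≤ E) (s : ℕ) :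
    Ideal.span (Set.range c) ^ (s * q + E) ≤
      Ideal.span (Set.range fun i => c i ^ q) ^ s * Ideal.span (Set.range c) ^ E := by
  induction s with
  | zero => simp
  | succ s ih =>
    rw [show (s + 1) * q + E = q + (s * q + E) by ring]
    refine (span_pow_add_le c (by omega)).trans ?_
    rw [pow_succ', mul_assoc]
    exact Ideal.mul_mono_right ih

section Reduction

variable {R : Type*} [CommRing R]

theorem exists_pow_le_of_pow_succ_le {B' B : Ideal R} {d : ℕ} (h : B ^ (d + 1) ≤ B' * B ^ d)
    (j : ℕ) : B ^ (j + d) ≤ B' ^ j := by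
  suffices B ^ (j + d) ≤ B' ^ j * B ^ d from this.trans Ideal.mul_le_left
  induction j with
  | zero => simp
  | succ j ih =>
    calc B ^ (j + 1 + d) = B ^ (j + d) * B := by rw [← pow_succ]; congr 1; omega
      _ ≤ B' ^ j * B ^ d * B := Ideal.mul_mono_left ih
      _ = B' ^ j * B ^ (d + 1) := by rw [pow_succ, mul_assoc]
      _ ≤ B' ^ j * (B' * B ^ d) := Ideal.mul_mono_right h
      _ = B' ^ (j + 1) * B ^ d := by rw [pow_succ, mul_assoc]

theorem sup_span_singleton_pow_succ_le (B' : Ideal R) (z : R) (j : ℕ) :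
    (B' ⊔ Ideal.span {z}) ^ (j + 1) ≤
      B' * (B' ⊔ Ideal.span {z}) ^ j ⊔ Ideal.span {z ^ (j + 1)} := by
  induction j with
  | zero => simp
  | succ j ih =>
    set B := B' ⊔ Ideal.span {z} with hB
    calc B ^ (j + 1 + 1) = B ^ (j + 1) * B := pow_succ _ _
      _ ≤ (B' * B ^ j ⊔ Ideal.span {z ^ (j + 1)}) * B := Ideal.mul_mono_left ih
      _ ≤ _ := by
        rw [Ideal.sup_mul, mul_assoc, ← pow_succ]
        refine sup_le le_sup_left ?_
        conv_lhs => rw [hB]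
        rw [Ideal.mul_sup, Ideal.span_singleton_mul_span_singleton, ← pow_succ]
        refine sup_le (le_sup_of_le_left ?_) le_sup_right
        rw [mul_comm]
        refine Ideal.mul_mono_right ?_
        rw [Ideal.span_singleton_le_iff_mem]
        exact Ideal.pow_mem_pow (Ideal.mem_sup_right (Ideal.mem_span_singleton_self z)) _

theorem multiset_prod_mem_pow_card {ι : Type*} {B : Ideal R} {x : ι → R} (hx : ∀ i, x i ∈ B)
    (s : Multiset ι) : (s.map x).prod ∈ B ^ Multiset.card s := by
  induction s using Multiset.induction_on with
  | empty => simp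
  | cons i s ih =>
    rw [Multiset.map_cons, Multiset.prod_cons, Multiset.card_cons, pow_succ']
    exact Ideal.mul_mem_mul (hx i) ih

theorem prod_sub_prod_mul_mem {ι : Type*} {B' B : Ideal R} {x y : ι → R}
    (hx : ∀ i, x i ∈ B) (hy : ∀ i, y i ∈ B) (hxy : ∀ i, x i - y i ∈ B') {z : R} (hz : z ∈ B)
    (s : Multiset ι) :
    ((s.map x).prod - (s.map y).prod) * z ∈ B' * B ^ Multiset.card s := by
  induction s using Multiset.induction_on with
  | empty => simp
  | cons i s ih =>
    rw [Multiset.map_cons, Multiset.map_cons, Multiset.prod_cons, Multiset.prod_cons,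
      Multiset.card_cons,
      show (x i * (s.map x).prod - y i * (s.map y).prod) * z = (x i - y i) *
        ((s.map x).prod * z) + ((s.map x).prod - (s.map y).prod) * z * y i by ring]
    refine add_mem (Ideal.mul_mem_mul (hxy i) ?_) ?_
    · rw [pow_succ]; exact Ideal.mul_mem_mul (multiset_prod_mem_pow_card hx s) hz
    · rw [pow_succ, ← mul_assoc]; exact Ideal.mul_mem_mul ih (hy i)

variable {K : Type*} [Field K] [Algebra K R]

theorem aeval_sub_aeval_mul_mem {ι : Type*} {B' B : Ideal R} {x y : ι → R}
    (hx : ∀ i, x i ∈ B) (hy : ∀ i, y i ∈ B) (hxy : ∀ i, x i - y i ∈ B') {z : R} (hz : z ∈ B)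
    {d : ℕ} {P : MvPolynomial ι K} (hP : P.IsHomogeneous d) :
    (aeval x P - aeval y P) * z ∈ B' * B ^ d := by
  rw [aeval_def, aeval_def, eval₂_eq, eval₂_eq, ← Finset.sum_sub_distrib, Finset.sum_mul]
  refine sum_mem fun β hβ => ?_
  rw [← mul_sub, mul_assoc]
  refine Ideal.mul_mem_left _ _ ?_
  have h := prod_sub_prod_mul_mem hx hy hxy hz (Finsupp.toMultiset β)
  have hd : Multiset.card (Finsupp.toMultiset β) = d := by
    have := hP (mem_support_iff.1 hβ)
    rw [← this, Finsupp.card_toMultiset, Finsupp.weight_apply]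
    simp [Finsupp.sum]
  have hprod (w : ι → R) : ((Finsupp.toMultiset β).map w).prod = ∏ i ∈ β.support, w i ^ β i := by
    rw [Finsupp.toMultiset_map, Finsupp.prod_toMultiset, Finsupp.prod_mapDomain_index (by simp)
      (fun _ _ _ => pow_add _ _ _), Finsupp.prod]
  rwa [hd, hprod, hprod] at h

/-- A homogeneous relation among the generators of an ideal allows to discard one of them up to
integral closure. -/
theorem exists_reduction_of_relation [Infinite K] {r d : ℕ} (b : Fin (r + 1) → R)
    {P : MvPolynomial (Fin (r + 1)) K} (hP : P.IsHomogeneous d) (hP0 : P ≠ 0)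
    (hPb : aeval b P = 0) :
    ∃ b' : Fin r → R, Ideal.span (Set.range b') ≤ Ideal.span (Set.range b) ∧
      Ideal.span (Set.range b) ^ (d + 1) ≤
        Ideal.span (Set.range b') * Ideal.span (Set.range b) ^ d := by
  obtain ⟨a, ha⟩ : ∃ a, eval a (P * X 0) ≠ 0 := by
    by_contra! h
    exact mul_ne_zero hP0 (X_ne_zero 0) (MvPolynomial.funext fun a => by rw [h a, map_zero])
  rw [map_mul, eval_X] at ha
  have ha0 : a 0 ≠ 0 := right_ne_zero_of_mul ha
  have haP : eval a P ≠ 0 := left_ne_zero_of_mul ha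
  set y : Fin (r + 1) → R := fun i => algebraMap K R (a i) * (algebraMap K R (a 0)⁻¹ * b 0)
  have hy0 : y 0 = b 0 := by
    simp only [y]
    rw [← mul_assoc, ← map_mul, mul_inv_cancel₀ ha0, map_one, one_mul]
  have hyP : aeval y P = algebraMap K R (eval a P) * (algebraMap K R (a 0)⁻¹ * b 0) ^ d := by
    rw [aeval_def, eval₂_eq, eval_eq, map_sum, Finset.sum_mul]
    refine Finset.sum_congr rfl fun β hβ => ?_
    have hd : ∑ i ∈ β.support, β i = d := by
      have := hP (mem_support_iff.1 hβ)
      rw [← this, Finsupp.weight_apply]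
      simp [Finsupp.sum]
    simp only [y, mul_pow, Finset.prod_mul_distrib, Finset.prod_pow_eq_pow_sum, hd, map_mul,
      map_prod, map_pow]
    ring
  set B := Ideal.span (Set.range b)
  have hb (i) : b i ∈ B := Ideal.subset_span (Set.mem_range_self i)
  have hyB (i) : y i ∈ B := Ideal.mul_mem_left _ _ (Ideal.mul_mem_left _ _ (hb 0))
  set b' : Fin r → R := fun i => b i.succ - y i.succ
  set B' := Ideal.span (Set.range b')
  have hle : B' ≤ B := Ideal.span_le.2 (by
    rintro _ ⟨i, rfl⟩
    exact sub_mem (hb _) (hyB _))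
  have hby (i) : b i - y i ∈ B' := by
    refine Fin.cases ?_ (fun i => ?_) i
    · rw [hy0, sub_self]; exact zero_mem _
    · exact Ideal.subset_span (Set.mem_range_self i)
  have hpow : b 0 ^ (d + 1) ∈ B' * B ^ d := by
    have h1 := aeval_sub_aeval_mul_mem hb hyB hby (hb 0) hP
    rw [hPb, hyP, zero_sub] at h1
    have h2 := Ideal.mul_mem_left _ (-algebraMap K R ((eval a P)⁻¹ * a 0 ^ d)) h1
    convert h2 using 1
    calc b 0 ^ (d + 1) = algebraMap K R 1 * b 0 ^ (d + 1) := by rw [map_one, one_mul]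
      _ = algebraMap K R (((eval a P)⁻¹ * eval a P) * (a 0 * (a 0)⁻¹) ^ d) * b 0 ^ (d + 1) := by
        rw [inv_mul_cancel₀ haP, mul_inv_cancel₀ ha0, one_pow, one_mul]
      _ = _ := by simp only [map_mul, map_pow]; ring
  have hB : B = B' ⊔ Ideal.span {b 0} := by
    refine le_antisymm (Ideal.span_le.2 ?_)
      (sup_le hle ((Ideal.span_singleton_le_iff_mem _).2 (hb 0)))
    rintro _ ⟨i, rfl⟩
    rw [← sub_add_cancel (b i) (y i)]
    refine add_mem (Ideal.mem_sup_left (hby i)) (Ideal.mem_sup_right ?_)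
    exact Ideal.mul_mem_left _ _ (Ideal.mul_mem_left _ _ (Ideal.mem_span_singleton_self _))
  refine ⟨b', hle, ?_⟩
  have h := sup_span_singleton_pow_succ_le B' (b 0) d
  rw [← hB] at h
  exact h.trans (sup_le le_rfl ((Ideal.span_singleton_le_iff_mem _).2 hpow))

end Reduction

theorem coeff_aeval_C_mul_X {ι K R : Type*} [CommRing K] [CommRing R] [Algebra K R] (b : ι → R)
    (P : MvPolynomial ι K) (d : ℕ) :
    (aeval (fun i => Polynomial.C (b i) * Polynomial.X) P).coeff d =
      aeval b (homogeneousComponent d P) := by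
  induction P using MvPolynomial.induction_on' with
  | add p q hp hq => simp only [map_add, Polynomial.coeff_add, hp, hq]
  | monomial β a =>
    have h : (aeval (fun i => Polynomial.C (b i) * Polynomial.X)) (monomial β a) =
        Polynomial.C (aeval b (monomial β a)) * Polynomial.X ^ β.degree := by
      rw [aeval_monomial, aeval_monomial, Finsupp.prod, Finsupp.prod]
      simp only [mul_pow, Finset.prod_mul_distrib, Finset.prod_pow_eq_pow_sum, map_mul, map_prod,
        map_pow, Polynomial.algebraMap_apply, Finsupp.degree_apply, mul_assoc]
    rw [h, Polynomial.coeff_C_mul, Polynomial.coeff_X_pow,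
      homogeneousComponent_of_mem (isHomogeneous_monomial a rfl)]
    split_ifs <;> simp

theorem exists_homogeneous_relation {K : Type*} [Field K] {n r : ℕ} (hr : n + 1 < r)
    (b : Fin r → MvPolynomial (Fin n) K) :
    ∃ (d : ℕ) (P : MvPolynomial (Fin r) K), P.IsHomogeneous d ∧ P ≠ 0 ∧ aeval b P = 0 := by
  have hdep : ¬ AlgebraicIndependent K
      fun i => (finSuccEquiv K n).symm (Polynomial.C (b i) * Polynomial.X) := by
    intro h
    have h1 := h.lift_cardinalMk_le_trdeg
    rw [MvPolynomial.trdeg_of_isDomain] at h1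
    simp only [Cardinal.mk_fin, Cardinal.lift_natCast] at h1
    norm_cast at h1
    omega
  rw [algebraicIndependent_iff] at hdep
  push Not at hdep
  obtain ⟨P, hP, hP0⟩ := hdep
  have hP' : aeval (fun i => Polynomial.C (b i) * Polynomial.X) P = 0 := by
    apply (finSuccEquiv K n).symm.injective
    rw [map_zero, ← hP]
    exact comp_aeval_apply _ (finSuccEquiv K n).symm.toAlgHom P
  obtain ⟨d, hd⟩ : ∃ d, homogeneousComponent d P ≠ 0 := by
    by_contra! h
    exact hP0 (by rw [← sum_homogeneousComponent P]; exact Finset.sum_eq_zero fun d _ => h d)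
  refine ⟨d, _, homogeneousComponent_isHomogeneous d P, hd, ?_⟩
  rw [← coeff_aeval_C_mul_X, hP', Polynomial.coeff_zero]

/-- Every ideal of a polynomial ring in `n` variables over an infinite field is, up to integral
closure, generated by `n + 1` elements. -/
theorem exists_reduction {K : Type*} [Field K] [Infinite K] {n r : ℕ}
    (b : Fin r → MvPolynomial (Fin n) K) :
    ∃ c : Fin (n + 1) → MvPolynomial (Fin n) K,
      Ideal.span (Set.range c) ≤ Ideal.span (Set.range b) ∧
      ∃ N, ∀ j, Ideal.span (Set.range b) ^ (j + N) ≤ Ideal.span (Set.range c) ^ j := by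
  induction r with
  | zero => exact ⟨0, by simp, 1, by simp⟩
  | succ r ih =>
    by_cases hr : r + 1 ≤ n + 1
    · refine ⟨fun i => if h : i.1 < r + 1 then b ⟨i, h⟩ else 0, Ideal.span_le.2 ?_, 0, fun j => ?_⟩
      · rintro _ ⟨i, rfl⟩
        dsimp only
        split_ifs with h
        · exact Ideal.subset_span (Set.mem_range_self _)
        · exact zero_mem _
      · refine Ideal.pow_right_mono (Ideal.span_le.2 ?_) _
        rintro _ ⟨i, rfl⟩
        refine Ideal.subset_span ⟨⟨i, by omega⟩, dif_pos i.2⟩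
    · obtain ⟨d, P, hP, hP0, hPb⟩ := exists_homogeneous_relation (by omega) b
      obtain ⟨b', hle, hpow⟩ := exists_reduction_of_relation b hP hP0 hPb
      obtain ⟨c, hc, N, hN⟩ := ih b'
      refine ⟨c, hc.trans hle, N + d, fun j => ?_⟩
      rw [← add_assoc]
      exact (exists_pow_le_of_pow_succ_le hpow _).trans (hN j)

section CharP

variable {K : Type*} [Field K] {p : ℕ} [Fact p.Prime] [CharP K p] [PerfectRing K p] {n ν N : ℕ}
  {B : Ideal (MvPolynomial (Fin n) K)} {c : Fin (ν + 1) → MvPolynomial (Fin n) K}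

theorem span_range_pow_eq_map_iterateFrobenius (c : Fin (ν + 1) → MvPolynomial (Fin n) K)
    (p : ℕ) [Fact p.Prime] [CharP K p] (s e : ℕ) :
    Ideal.span (Set.range fun i => c i ^ p ^ e) ^ s =
      (Ideal.span (Set.range c) ^ s).map (iterateFrobenius (MvPolynomial (Fin n) K) p e) := by
  rw [Ideal.map_pow, Ideal.map_span, ← Set.range_comp]
  rfl

theorem exists_mem_pow_ne_zero (hB : B ≠ ⊥) (j : ℕ) : ∃ d ∈ B ^ j, d ≠ 0 :=
  Submodule.exists_mem_ne_zero_of_ne_bot (pow_ne_zero j hB)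

/-- A Briançon–Skoda type statement in terms of tight closure. -/
theorem mem_pow_of_forall_mul_pow_mem (hB : B ≠ ⊥)
    (hN : ∀ j, B ^ (j + N) ≤ Ideal.span (Set.range c) ^ j) {d u : MvPolynomial (Fin n) K}
    (hd : d ≠ 0) {t : ℕ} (h : ∀ e, d * u ^ p ^ e ∈ B ^ (t * p ^ e)) :
    u ∈ Ideal.span (Set.range c) ^ (t - ν) := by
  rcases lt_or_ge t ν with htν | htν
  · rw [Nat.sub_eq_zero_of_le htν.le, pow_zero, Ideal.one_eq_top]
    exact Submodule.mem_top
  obtain ⟨s, rfl⟩ := Nat.exists_eq_add_of_le' htν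
  rw [Nat.add_sub_cancel]
  obtain ⟨d₁, hd₁, hd₁0⟩ := exists_mem_pow_ne_zero hB N
  obtain ⟨e, he⟩ : ∃ e, (d₁ * d).totalDegree < p ^ e :=
    ⟨_, Nat.lt_pow_self (Fact.out : p.Prime).one_lt⟩
  refine mem_of_mul_pow_mem p (mul_ne_zero hd₁0 hd) he ?_
  rw [← span_range_pow_eq_map_iterateFrobenius]
  have h1 : d₁ * d * u ^ p ^ e ∈ B ^ (s * p ^ e + ν * p ^ e + N) := by
    rw [mul_assoc, add_comm, pow_add, ← add_mul]
    exact Ideal.mul_mem_mul hd₁ (h e)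
  have h2 := (span_pow_mul_add_le c (Nat.mul_le_mul_left ν (Nat.sub_le (p ^ e) 1)) s).trans
    Ideal.mul_le_left
  exact h2 (hN _ h1)

/-- The positive characteristic case of the uniform Artin–Rees theorem. -/
theorem mem_pow_of_mul_mem_pow_of_charP (p : ℕ) [Fact p.Prime] [CharP K p] [PerfectRing K p]
    (hB : B ≠ ⊥) (hc : Ideal.span (Set.range c) ≤ B)
    (hN : ∀ j, B ^ (j + N) ≤ Ideal.span (Set.range c) ^ j) {f g : MvPolynomial (Fin n) K}
    {m τ : ℕ} (hm : τ + 1 ≤ m) (hfg : f * g ∈ B ^ m)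
    (hτ : B ^ τ ≤ Ideal.span ({f} ∪ Set.range fun i => pderiv i f) ⊔ B ^ m) :
    g ∈ B ^ (m - 1 - τ - ν) := by
  obtain ⟨d, hdB, hd⟩ := exists_mem_pow_ne_zero hB (m - 1)
  have key (e : ℕ) {y} (hy : y ∈ B ^ τ) : d * g ^ p ^ e * y ^ p ^ e ∈ B ^ ((m - 1) * p ^ e) := by
    have hle : B ^ (m * p ^ e) ≤ B ^ ((m - 1) * p ^ e) :=
      Ideal.pow_le_pow_right (Nat.mul_le_mul_right _ (Nat.sub_le _ _))
    set L : Ideal (MvPolynomial (Fin n) K) := Ideal.comap (iterateFrobenius _ p e)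
      (Submodule.comap (LinearMap.mulLeft _ (d * g ^ p ^ e)) (B ^ ((m - 1) * p ^ e))) with hL
    have hmem (z) : z ∈ L ↔ d * g ^ p ^ e * z ^ p ^ e ∈ B ^ ((m - 1) * p ^ e) := by
      rw [hL, Ideal.mem_comap, iterateFrobenius_def, Submodule.mem_comap,
        LinearMap.mulLeft_apply]
    suffices B ^ τ ≤ L from (hmem y).1 (this hy)
    refine hτ.trans (sup_le (Ideal.span_le.2 ?_) fun y hy => ?_)
    · rintro _ (rfl | ⟨i, rfl⟩)
      · rw [SetLike.mem_coe, hmem, mul_assoc, ← mul_pow, mul_comm g]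
        exact Ideal.mul_mem_left _ _ (hle (pow_mul B m _ ▸ Ideal.pow_mem_pow hfg _))
      · rw [SetLike.mem_coe, hmem]
        have h1 := Ideal.mul_mem_mul hdB (pow_mul_pderiv_mem p i hfg e)
        rw [mul_assoc, ← mul_pow]
        rwa [← pow_add, add_comm, ← Nat.mul_add_one,
          Nat.sub_add_cancel (Nat.one_le_pow _ _ (Fact.out : p.Prime).pos)] at h1
    · rw [hmem]
      exact Ideal.mul_mem_left _ _ (hle (pow_mul B m _ ▸ Ideal.pow_mem_pow hy _))
  obtain ⟨d₂, hd₂B, hd₂⟩ := exists_mem_pow_ne_zero hB (N + ν)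
  refine Ideal.pow_right_mono hc _ <| mem_pow_of_forall_mul_pow_mem (p := p) hB hN
    (mul_ne_zero hd₂ hd) fun e => ?_
  set Q := p ^ e
  set G := d * g ^ Q with hG
  set T := (m - 1 - τ) * Q - N with hT
  set A := τ * Q + ν * Q + N
  have hGA : Ideal.span {G} * B ^ A ≤ B ^ (A + T) := by
    rcases Nat.eq_zero_or_pos T with hT0 | hT0
    · rw [hT0]; exact Ideal.mul_le_right
    have hτQ : (m - 1) * Q = (m - 1 - τ) * Q + τ * Q := by
      rw [← add_mul, Nat.sub_add_cancel (by omega)]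
    calc Ideal.span {G} * B ^ A
        ≤ Ideal.span {G} * (Ideal.span (Set.range fun i => c i ^ Q) ^ τ * B ^ (ν * Q)) :=
          Ideal.mul_mono_right ((hN _).trans ((span_pow_mul_add_le c
            (Nat.mul_le_mul_left ν (Nat.sub_le _ 1)) τ).trans
              (Ideal.mul_mono_right (Ideal.pow_right_mono hc _))))
      _ ≤ B ^ ((m - 1) * Q) * B ^ (ν * Q) := by
          rw [← mul_assoc]
          refine Ideal.mul_mono_left ?_
          rw [span_range_pow_eq_map_iterateFrobenius, Ideal.map, Ideal.span_mul_span',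
            Ideal.span_le]
          rintro _ ⟨_, rfl, _, ⟨y, hy, rfl⟩, rfl⟩
          exact key e (Ideal.pow_right_mono hc _ hy)
      _ ≤ B ^ (A + T) := by
          rw [← pow_add]
          exact Ideal.pow_le_pow_right (by omega)
  have hGl (l : ℕ) : Ideal.span {G} ^ l * B ^ A ≤ B ^ (A + T * l) := by
    induction l with
    | zero => simp
    | succ l ih =>
      calc Ideal.span {G} ^ (l + 1) * B ^ A = Ideal.span {G} * (Ideal.span {G} ^ l * B ^ A) := by
            rw [pow_succ', mul_assoc]
        _ ≤ Ideal.span {G} * B ^ A * B ^ (T * l) := by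
            rw [mul_assoc, ← pow_add]; exact Ideal.mul_mono_right ih
        _ ≤ B ^ (A + T) * B ^ (T * l) := Ideal.mul_mono_left hGA
        _ = B ^ (A + T * (l + 1)) := by rw [← pow_add]; congr 1; ring
  obtain ⟨d₁, hd₁B, hd₁⟩ := exists_mem_pow_ne_zero hB A
  have hGT : G ∈ B ^ (T - ν) :=
    Ideal.pow_right_mono hc _ <| mem_pow_of_forall_mul_pow_mem (p := p) hB hN hd₁ fun e' => by
      refine Ideal.pow_le_pow_right (Nat.le_add_left _ A) (hGl (p ^ e') ?_)
      rw [mul_comm d₁]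
      exact Ideal.mul_mem_mul (Ideal.pow_mem_pow (Ideal.mem_span_singleton_self G) (p ^ e')) hd₁B
  rw [mul_assoc]
  have h1 := Ideal.mul_mem_mul hd₂B hGT
  rw [← pow_add] at h1
  exact Ideal.pow_le_pow_right (by omega) h1

end CharP

section JetFunctional

variable {σ R R' : Type*} [CommRing R] [CommRing R']

/-- The linear functional `h ↦ ∑_{β ∈ F} ℓ β * h_β`, where `h_β` is the coefficient of `h` at
`(x - a)^β`. -/
noncomputable def jetFunctional (a : σ → R) (F : Finset (σ →₀ ℕ)) (ℓ : (σ →₀ ℕ) → R) :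
    MvPolynomial σ R →ₗ[R] R :=
  ∑ β ∈ F, ℓ β • (lcoeff R β).comp (aeval fun i => X i + C (a i)).toLinearMap

theorem jetFunctional_apply (a : σ → R) (F : Finset (σ →₀ ℕ)) (ℓ : (σ →₀ ℕ) → R)
    (h : MvPolynomial σ R) :
    jetFunctional a F ℓ h = ∑ β ∈ F, ℓ β * coeff β (aeval (fun i => X i + C (a i)) h) := by
  simp [jetFunctional]

theorem jetFunctional_map (φ : R →+* R') (a : σ → R) (F : Finset (σ →₀ ℕ)) (ℓ : (σ →₀ ℕ) → R)
    (h : MvPolynomial σ R) :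
    jetFunctional (φ ∘ a) F (φ ∘ ℓ) (map φ h) = φ (jetFunctional a F ℓ h) := by
  rw [jetFunctional_apply, jetFunctional_apply, map_sum]
  refine Finset.sum_congr rfl fun β _ => ?_
  have hcomm : aeval (fun i => X i + C ((φ ∘ a) i)) (map φ h) =
      map φ (aeval (fun i => X i + C (a i)) h) := by
    induction h using MvPolynomial.induction_on with
    | C r => simp
    | add p q hp hq => simp only [map_add, hp, hq]
    | mul_X p i hp => rw [map_mul, map_mul, hp, map_mul, map_mul]; simp
  rw [map_mul, ← coeff_map, hcomm, Function.comp_apply]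

theorem exists_notMem_sup_pow_isMaximal [IsNoetherianRing R] {I : Ideal R} {g : R} (hg : g ∉ I) :
    ∃ M : Ideal R, M.IsMaximal ∧ ∃ D, g ∉ I ⊔ M ^ D := by
  have hne : (Submodule.comap (LinearMap.mulRight R g) I : Ideal R) ≠ ⊤ := by
    rw [Ideal.ne_top_iff_one]
    simpa using hg
  obtain ⟨M, hM, hle⟩ := Ideal.exists_le_maximal _ hne
  refine ⟨M, hM, ?_⟩
  by_contra! h
  have h1 : Ideal.Quotient.mk I g ∈ ⨅ D, M ^ D • (⊤ : Submodule R (R ⧸ I)) := by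
    rw [Submodule.mem_iInf]
    intro D
    obtain ⟨u, hu, v, hv, rfl⟩ := Submodule.mem_sup.1 (h D)
    rw [map_add, Ideal.Quotient.eq_zero_iff_mem.2 hu, zero_add]
    have := Submodule.smul_mem_smul hv (Submodule.mem_top (x := Ideal.Quotient.mk I 1))
    simpa [Algebra.smul_def] using this
  obtain ⟨r, hr⟩ := (Ideal.mem_iInf_smul_pow_eq_bot_iff M _).1 h1
  have h2 : (1 - r) * g ∈ I := by
    rw [← Ideal.Quotient.eq_zero_iff_mem, sub_mul, one_mul, map_sub, sub_eq_zero, eq_comm]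
    simpa [Algebra.smul_def] using hr
  have h3 : (1 : R) - r ∈ M := hle h2
  exact hM.ne_top ((Ideal.eq_top_iff_one M).2 (by simpa using add_mem h3 r.2))

theorem exists_jetFunctional {k : Type*} [Field k] [IsAlgClosed k] {n : ℕ}
    {I : Ideal (MvPolynomial (Fin n) k)} {g : MvPolynomial (Fin n) k} (hg : g ∉ I) :
    ∃ (a : Fin n → k) (F : Finset (Fin n →₀ ℕ)) (ℓ : (Fin n →₀ ℕ) → k),
      (∀ β ∉ F, ℓ β = 0) ∧ (∀ h ∈ I, jetFunctional a F ℓ h = 0) ∧ jetFunctional a F ℓ g = 1 := by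
  obtain ⟨M, hM, D, hD⟩ := exists_notMem_sup_pow_isMaximal hg
  obtain ⟨a, ha⟩ := isMaximal_iff_eq_vanishingIdeal_singleton.1 hM
  have haM (i) : X i - C (a i) ∈ M := by
    rw [ha, mem_vanishingIdeal_singleton_iff]; simp
  obtain ⟨μ₀, hμ₀, hμle⟩ := Submodule.exists_le_ker_of_notMem
    (p := (I ⊔ M ^ D).restrictScalars k) (v := g) fun h => hD h
  set μ := (μ₀ g)⁻¹ • μ₀ with hμ
  have hμz (h) (hh : h ∈ I ⊔ M ^ D) : μ h = 0 := by
    have : μ₀ h = 0 := hμle hh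
    simp [hμ, this]
  set F := Finset.Iic (Finsupp.equivFunOnFinite.symm fun _ : Fin n => D)
  set ℓ : (Fin n →₀ ℕ) → k := fun β => μ (∏ i, (X i - C (a i)) ^ β i)
  have hF (β) (hβ : β ∉ F) : ℓ β = 0 := by
    obtain ⟨i, hi⟩ : ∃ i, D < β i := by
      by_contra! h
      exact hβ (Finset.mem_Iic.2 fun i => by simpa using h i)
    refine hμz _ (Ideal.mem_sup_right ?_)
    rw [← Finset.mul_prod_erase _ _ (Finset.mem_univ i)]
    exact Ideal.mul_mem_right _ _ (Ideal.pow_le_pow_right hi.le (Ideal.pow_mem_pow (haM i) _))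
  have hrepr (h : MvPolynomial (Fin n) k) : jetFunctional a F ℓ h = μ h := by
    set t := aeval (fun i => X i + C (a i)) h with ht
    have hinv : h = aeval (fun i => X i - C (a i)) t := by
      rw [ht, ← AlgHom.comp_apply]
      conv_lhs => rw [← AlgHom.id_apply (R := k) h]
      congr 1
      ext i : 1
      simp
    have h1 : μ h = ∑ β ∈ t.support, ℓ β * coeff β t := by
      conv_lhs => rw [hinv, aeval_def, eval₂_eq', map_sum]
      refine Finset.sum_congr rfl fun β _ => ?_
      rw [← Algebra.smul_def, map_smul, smul_eq_mul, mul_comm]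
    rw [h1, jetFunctional_apply]
    refine (Finset.sum_subset Finset.subset_union_left ?_).trans
      (Finset.sum_subset Finset.subset_union_right ?_).symm
    · intro β _ hβ; rw [hF β hβ, zero_mul]
    · intro β _ hβ; rw [notMem_support_iff.1 hβ, mul_zero]
  refine ⟨a, F, ℓ, hF, fun h hh => ?_, ?_⟩
  · rw [hrepr]; exact hμz _ (Ideal.mem_sup_left hh)
  · rw [hrepr]; simp [hμ, hμ₀]

end JetFunctional

universe u

instance Int.isJacobsonRing_s9 : IsJacobsonRing ℤ := by
  refine isJacobsonRing_iff_prime_eq.2 fun P hP => ?_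
  by_cases h : P = ⊥
  · subst h
    refine (Submodule.eq_bot_iff _).2 fun x hx => ?_
    rcases Int.isUnit_iff.1 (Ideal.mem_jacobson_bot.1 hx x) with h | h <;> nlinarith
  · have := hP.isMaximal h
    exact Ideal.jacobson_eq_self_of_isMaximal

theorem exists_charP_of_finiteType_int (F : Type*) [Field F] [Algebra.FiniteType ℤ F] :
    ∃ p : ℕ, Fact p.Prime ∧ CharP F p := by
  have : Module.Finite ℤ F := finite_of_finite_type_of_isJacobsonRing ℤ F
  obtain ⟨p, hp⟩ := CharP.exists F
  have hp0 : p ≠ 0 := by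
    rintro rfl
    have := CharP.charP_to_charZero F
    exact Int.not_isField
      (isField_of_isIntegral_of_isField (algebraMap ℤ F).injective_int (Field.toIsField F))
  exact ⟨p, ⟨(CharP.char_is_prime_or_zero F p).resolve_right hp0⟩, hp⟩

theorem exists_ringHom_charP (A : Type u) [CommRing A] [Nontrivial A] [Algebra.FiniteType ℤ A] :
    ∃ (p : ℕ) (_ : Fact p.Prime) (K : Type u) (_ : Field K) (_ : IsAlgClosed K) (_ : CharP K p),
      Nonempty (A →+* K) := by
  obtain ⟨F, _, ψ, hψ⟩ : ∃ (F : Type u) (_ : Field F) (ψ : A →+* F), Function.Surjective ψ := by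
    obtain ⟨M, hM⟩ := Ideal.exists_maximal A
    exact ⟨A ⧸ M, Ideal.Quotient.field M, Ideal.Quotient.mk M, Ideal.Quotient.mk_surjective⟩
  have : Algebra.FiniteType ℤ F := Algebra.FiniteType.of_surjective ψ.toIntAlgHom hψ
  obtain ⟨p, hp, hF⟩ := exists_charP_of_finiteType_int F
  have : CharP (AlgebraicClosure F) p := charP_of_injective_algebraMap' F p
  exact ⟨p, hp, AlgebraicClosure F, inferInstance, inferInstance, this,
    ⟨(algebraMap F (AlgebraicClosure F)).comp ψ⟩⟩

theorem exists_map_eq_of_coeffs_subset {k σ : Type*} [Field k] {A : Subalgebra ℤ k}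
    {h : MvPolynomial σ k} (hA : (h.coeffs : Set k) ⊆ A) :
    ∃ h' : MvPolynomial σ A, map (algebraMap A k) h' = h :=
  mem_range_map_iff_coeffs_subset.2 (hA.trans fun x hx => ⟨⟨x, hx⟩, rfl⟩)

theorem exists_finset_forall_mem_span {k σ ι : Type*} [Field k] [Fintype ι]
    {u : ι → MvPolynomial σ k} {h : MvPolynomial σ k} (hh : h ∈ Ideal.span (Set.range u)) :
    ∃ S : Finset k, ∀ A : Subalgebra ℤ k, (S : Set k) ⊆ A →
      ∀ (u' : ι → MvPolynomial σ A) (h' : MvPolynomial σ A),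
        (∀ i, map (algebraMap A k) (u' i) = u i) → map (algebraMap A k) h' = h →
          h' ∈ Ideal.span (Set.range u') := by
  classical
  obtain ⟨c, rfl⟩ := Ideal.mem_span_range_iff_exists_fun.1 hh
  refine ⟨Finset.univ.biUnion fun i => (c i).coeffs, fun A hA u' h' hu hh' => ?_⟩
  choose c' hc' using fun i => exists_map_eq_of_coeffs_subset (h := c i) (A := A)
    (subset_trans (Finset.coe_subset.2 (Finset.subset_biUnion_of_mem (fun i => (c i).coeffs)
      (Finset.mem_univ i))) hA)
  refine Ideal.mem_span_range_iff_exists_fun.2 ⟨c', map_injective (algebraMap A k)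
    Subtype.val_injective ?_⟩
  simp only [map_sum, map_mul, hc', hu, hh']

theorem span_range_pow {R ι : Type*} [CommRing R] (b : ι → R) (m : ℕ) :
    Ideal.span (Set.range b) ^ m = Ideal.span (Set.range fun t : Fin m → ι => ∏ j, b (t j)) := by
  rw [Ideal.span, Submodule.span_pow, Ideal.span]
  congr 1
  ext x
  rw [Set.mem_pow]
  constructor
  · rintro ⟨t, rfl⟩
    choose s hs using fun j => (t j).2
    exact ⟨s, by simp [hs, List.prod_ofFn]⟩
  · rintro ⟨t, rfl⟩
    exact ⟨fun j => ⟨b (t j), Set.mem_range_self _⟩, by simp [List.prod_ofFn]⟩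

/-- Generators of the sum of the Jacobian ideal of a polynomial and a power of an ideal. -/
noncomputable def jacobianGenerators {R σ ι : Type*} [CommRing R] (f : MvPolynomial σ R)
    (b : ι → MvPolynomial σ R) (m : ℕ) : (Unit ⊕ σ) ⊕ (Fin m → ι) → MvPolynomial σ R :=
  Sum.elim (Sum.elim (fun _ => f) fun i => pderiv i f) fun t => ∏ j, b (t j)

theorem span_range_jacobianGenerators {R σ ι : Type*} [CommRing R] (f : MvPolynomial σ R)
    (b : ι → MvPolynomial σ R) (m : ℕ) :
    Ideal.span (Set.range (jacobianGenerators f b m)) =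
      Ideal.span ({f} ∪ Set.range fun i => pderiv i f) ⊔ Ideal.span (Set.range b) ^ m := by
  rw [jacobianGenerators, Set.Sum.elim_range, Set.Sum.elim_range, Set.range_const,
    Ideal.span_union, span_range_pow]

theorem map_jacobianGenerators {R R' σ ι : Type*} [CommRing R] [CommRing R'] (φ : R →+* R')
    (f : MvPolynomial σ R) (b : ι → MvPolynomial σ R) (m : ℕ) (z) :
    map φ (jacobianGenerators f b m z) =
      jacobianGenerators (map φ f) (fun i => map φ (b i)) m z := by
  rcases z with (_ | i) | t <;> simp [jacobianGenerators, pderiv_map]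

theorem jetFunctional_eq_zero_of_mem_map {k K σ : Type*} [Field k] [Field K] {A : Subalgebra ℤ k}
    (φ : A →+* K) (a : σ → A) (F : Finset (σ →₀ ℕ)) (ℓ : (σ →₀ ℕ) → A)
    {I : Ideal (MvPolynomial σ A)}
    (hI : ∀ h ∈ I.map (map (algebraMap A k)),
      jetFunctional (algebraMap A k ∘ a) F (algebraMap A k ∘ ℓ) h = 0)
    {h : MvPolynomial σ K} (hh : h ∈ I.map (map φ)) : jetFunctional (φ ∘ a) F (φ ∘ ℓ) h = 0 := by
  suffices ∀ q, jetFunctional (φ ∘ a) F (φ ∘ ℓ) (q * h) = 0 by simpa using this 1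
  refine Submodule.span_induction ?_ (by simp) (fun y z _ _ hy hz q => ?_)
    (fun y z _ hz q => ?_) hh
  · rintro _ ⟨w, hw, rfl⟩ q
    induction q using MvPolynomial.induction_on' with
    | add p q hp hq => rw [add_mul, map_add, hp, hq, add_zero]
    | monomial γ c =>
      have h1 : monomial γ c * map φ w = c • map φ (monomial γ 1 * w) := by
        rw [map_mul, map_monomial, map_one, ← smul_mul_assoc, smul_monomial, smul_eq_mul, mul_one]
      have h2 : jetFunctional a F ℓ (monomial γ 1 * w) = 0 :=
        FaithfulSMul.algebraMap_injective A k (by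
          rw [map_zero, ← jetFunctional_map]
          exact hI _ (Ideal.mem_map_of_mem _ (Ideal.mul_mem_left _ _ hw)))
      rw [h1, map_smul, jetFunctional_map, h2, map_zero, smul_zero]
  · rw [mul_add, map_add, hy, hz, add_zero]
  · rw [smul_eq_mul, ← mul_assoc]; exact hz _

theorem mem_pow_of_forall_charP {k : Type u} [Field k] [IsAlgClosed k] {n m τ s : ℕ}
    (H : ∀ (K : Type u) [Field K] [IsAlgClosed K] (p : ℕ) [Fact p.Prime] [CharP K p]
      (B : Ideal (MvPolynomial (Fin n) K)) (f g : MvPolynomial (Fin n) K), B ≠ ⊥ → f * g ∈ B ^ m →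
      B ^ τ ≤ Ideal.span ({f} ∪ Set.range fun i => pderiv i f) ⊔ B ^ m → g ∈ B ^ s)
    {B : Ideal (MvPolynomial (Fin n) k)} {f g : MvPolynomial (Fin n) k} (hB : B ≠ ⊥)
    (hfg : f * g ∈ B ^ m)
    (hτ : B ^ τ ≤ Ideal.span ({f} ∪ Set.range fun i => pderiv i f) ⊔ B ^ m) : g ∈ B ^ s := by
  classical
  by_contra hg
  obtain ⟨a, F, ℓ, hℓ, hI, hgℓ⟩ := exists_jetFunctional hg
  obtain ⟨r, b, rfl⟩ := Submodule.fg_iff_exists_fin_generating_family.1 (IsNoetherian.noetherian B)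
  change Ideal.span (Set.range b) ≠ ⊥ at hB
  change f * g ∈ Ideal.span (Set.range b) ^ m at hfg
  change Ideal.span (Set.range b) ^ τ ≤ _ ⊔ Ideal.span (Set.range b) ^ m at hτ
  change ∀ h ∈ Ideal.span (Set.range b) ^ s, _ at hI
  obtain ⟨i₀, hi₀⟩ : ∃ i, b i ≠ 0 := by
    by_contra! h
    exact hB (Ideal.span_eq_bot.2 (by rintro _ ⟨i, rfl⟩; exact h i))
  obtain ⟨γ, hγ⟩ := ne_zero_iff.1 hi₀
  rw [span_range_pow] at hfg
  obtain ⟨S₁, hS₁⟩ := exists_finset_forall_mem_span hfg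
  rw [← span_range_jacobianGenerators, span_range_pow] at hτ
  choose S₂ hS₂ using fun t : Fin τ → Fin r =>
    exists_finset_forall_mem_span (hτ (Ideal.subset_span (Set.mem_range_self t)))
  obtain ⟨S, hS⟩ : ∃ S : Finset k, S = S₁ ∪ Finset.univ.biUnion S₂ ∪ F.image ℓ ∪ Finset.univ.image a ∪
    {(coeff γ (b i₀))⁻¹} ∪ f.coeffs ∪ g.coeffs ∪ Finset.univ.biUnion fun i => (b i).coeffs := ⟨_, rfl⟩
  set A := Algebra.adjoin ℤ (S : Set k)
  have : Algebra.FiniteType ℤ A :=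
    (Subalgebra.fg_iff_finiteType _).1 (Subalgebra.fg_adjoin_finset S)
  obtain ⟨p, _, K, _, _, _, ⟨φ⟩⟩ := exists_ringHom_charP A
  have hSA : (S : Set k) ⊆ A := Algebra.subset_adjoin
  simp only [hS, Finset.coe_union, Set.union_subset_iff, Finset.coe_biUnion, Finset.coe_image,
    Set.iUnion_subset_iff, Finset.coe_singleton, Set.singleton_subset_iff, Set.image_subset_iff,
    Finset.coe_univ, Set.mem_univ, true_imp_iff] at hSA
  obtain ⟨⟨⟨⟨⟨⟨⟨hA₁, hA₂⟩, hAℓ⟩, hAa⟩, hAγ⟩, hAf⟩, hAg⟩, hAb⟩ := hSA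
  obtain ⟨f', rfl⟩ := exists_map_eq_of_coeffs_subset hAf
  obtain ⟨g', rfl⟩ := exists_map_eq_of_coeffs_subset hAg
  choose b' hb' using fun i => exists_map_eq_of_coeffs_subset (hAb i)
  obtain rfl : (fun i => map (algebraMap A k) (b' i)) = b := funext hb'
  obtain ⟨a', rfl⟩ : ∃ a' : Fin n → A, algebraMap A k ∘ a' = a :=
    ⟨fun i => ⟨a i, hAa (Set.mem_univ i)⟩, rfl⟩
  obtain ⟨ℓ', rfl⟩ : ∃ ℓ' : (Fin n →₀ ℕ) → A, algebraMap A k ∘ ℓ' = ℓ :=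
    ⟨fun β => ⟨ℓ β, if h : β ∈ F then hAℓ h else by rw [hℓ β h]; exact zero_mem _⟩, rfl⟩
  have hinj := FaithfulSMul.algebraMap_injective A k
  have hmap {R : Type u} [CommRing R] (ψ : A →+* R) :
      (Ideal.span (Set.range b')).map (map ψ) = Ideal.span (Set.range fun i => map ψ (b' i)) := by
    rw [Ideal.map_span, ← Set.range_comp]; rfl
  set BK := Ideal.span (Set.range fun i => map φ (b' i))
  have hgK : map φ g' ∈ BK ^ s := by
    refine H K p BK (map φ f') (map φ g') ?_ ?_ ?_
    · intro h0
      have h1 : map φ (b' i₀) = 0 := Ideal.span_eq_bot.1 h0 _ (Set.mem_range_self i₀)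
      have h2 : φ (coeff γ (b' i₀)) = 0 := by rw [← coeff_map, h1, coeff_zero]
      have h3 : coeff γ (b' i₀) * ⟨_, hAγ⟩ = 1 := hinj (by
        rw [map_mul, map_one, ← coeff_map]
        exact mul_inv_cancel₀ hγ)
      have h4 := congrArg φ h3
      rw [map_mul, h2, zero_mul, map_one] at h4
      exact zero_ne_one h4
    · have h1 := hS₁ A hA₁ (fun t => ∏ j, b' (t j)) (f' * g') (by simp) (by simp)
      rw [← span_range_pow] at h1
      have h2 := Ideal.mem_map_of_mem (map φ) h1
      rwa [Ideal.map_pow, hmap, map_mul] at h2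
    · rw [← span_range_jacobianGenerators, span_range_pow, Ideal.span_le]
      rintro _ ⟨t, rfl⟩
      have h1 := hS₂ t A (hA₂ t) (jacobianGenerators f' b' m) (∏ j, b' (t j))
        (fun z => map_jacobianGenerators _ _ _ _ z) (by simp)
      have h2 := Ideal.mem_map_of_mem (map φ) h1
      rw [Ideal.map_span, ← Set.range_comp, map_prod] at h2
      rwa [show map φ ∘ jacobianGenerators f' b' m = jacobianGenerators (map φ f')
        (fun i => map φ (b' i)) m from _root_.funext (map_jacobianGenerators φ f' b' m)] at h2
  rw [show BK = _ from (hmap φ).symm, ← Ideal.map_pow] at hgK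
  have h0 := jetFunctional_eq_zero_of_mem_map φ a' F ℓ' (k := k) (fun h hh => hI h (by
    rwa [Ideal.map_pow, hmap] at hh)) hgK
  rw [jetFunctional_map] at h0 hgℓ
  have h1 : jetFunctional a' F ℓ' g' = 1 := hinj (by rw [hgℓ, map_one])
  rw [h1, map_one] at h0
  exact one_ne_zero h0

theorem exists_mul_sub_one_mem {R : Type*} [CommRing R] {P I : Ideal R} (hP : P.IsMaximal) {N : ℕ}
    (hN : P ^ N ≤ I) {s : R} (hs : s ∉ P) : ∃ t, s * t - 1 ∈ I := by
  have h1 : Ideal.span {s} ⊔ P ^ N = ⊤ := Ideal.sup_pow_eq_top (by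
    rw [sup_comm, ← hP.out.2 _ (lt_of_le_of_ne le_sup_left fun h => hs ?_)]
    rw [h]
    exact Ideal.mem_sup_right (Ideal.mem_span_singleton_self s))
  obtain ⟨u, hu, v, hv, huv⟩ := Submodule.mem_sup.1 ((Ideal.eq_top_iff_one _).1 h1)
  obtain ⟨t, rfl⟩ := Ideal.mem_span_singleton'.1 hu
  refine ⟨t, hN ?_⟩
  rw [← huv, mul_comm]
  simpa using neg_mem hv

theorem quotient_map_atPrime_surjective {R S : Type*} [CommRing R] {P I : Ideal R} [P.IsPrime]
    [CommRing S] [Algebra R S] [IsLocalization.AtPrime S P] (hP : P.IsMaximal) {N : ℕ}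
    (hN : P ^ N ≤ I) : Function.Surjective
      ((Ideal.Quotient.mk (I.map (algebraMap R S))).comp (algebraMap R S)) := by
  intro z
  obtain ⟨z, rfl⟩ := Ideal.Quotient.mk_surjective z
  obtain ⟨r, s, rfl⟩ := IsLocalization.exists_mk'_eq P.primeCompl z
  obtain ⟨t, ht⟩ := exists_mul_sub_one_mem hP hN s.2
  refine ⟨r * t, ?_⟩
  rw [RingHom.comp_apply, Ideal.Quotient.eq]
  have h1 : algebraMap R S (r * t) - IsLocalization.mk' S r s =
      IsLocalization.mk' S r s * algebraMap R S (s * t - 1) := by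
    rw [mul_comm r t, map_sub, map_mul, map_mul, map_one, ← IsLocalization.mk'_spec S r s]
    ring
  rw [h1]
  exact Ideal.mul_mem_left _ _ (Ideal.mem_map_of_mem _ ht)

theorem ker_quotient_map_atPrime {R S : Type*} [CommRing R] {P I : Ideal R} [P.IsPrime]
    [CommRing S] [Algebra R S] [IsLocalization.AtPrime S P] (hP : I.radical = P)
    (hPm : P.IsMaximal) :
    RingHom.ker ((Ideal.Quotient.mk (I.map (algebraMap R S))).comp (algebraMap R S)) = I := by
  rw [← RingHom.comap_ker, Ideal.mk_ker]
  refine IsLocalization.under_map_of_isPrimary_disjoint P.primeCompl S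
    (Ideal.isPrimary_of_isMaximal_radical (hP ▸ hPm)) ?_
  exact Set.disjoint_left.2 fun x hx hxI => hx (hP ▸ Ideal.le_radical hxI)

theorem pow_finrank_eq_bot {k A : Type*} [Field k] [CommRing A] [Algebra k A]
    [FiniteDimensional k A] {M : Ideal A} {N : ℕ} (hM : M ^ N = ⊥) :
    M ^ Module.finrank k A = ⊥ := by
  have key (i : ℕ) : M ^ i = ⊥ ∨
      Module.finrank k ((M ^ i).restrictScalars k) + i ≤ Module.finrank k A := by
    induction i with
    | zero => exact Or.inr (Submodule.finrank_le _)
    | succ i ih =>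
      rcases ih with h | h
      · left; rw [pow_succ, h, Ideal.bot_mul]
      · rcases (Ideal.pow_le_pow_right (I := M) (Nat.le_succ i)).eq_or_lt with heq | hlt
        · left
          have hst (j : ℕ) : M ^ (i + j) = M ^ i := by
            induction j with
            | zero => rfl
            | succ j ihj => rw [← add_assoc, pow_succ, ihj, ← pow_succ]; exact heq
          refine heq.trans ((hst N).symm.trans ?_)
          rw [pow_add, hM, Ideal.mul_bot]
        · right
          have := Submodule.finrank_lt_finrank_of_lt (K := k)
            (s := (M ^ (i + 1)).restrictScalars k) (t := (M ^ i).restrictScalars k) hlt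
          omega
  refine (key _).elim id fun h => ?_
  have h0 : (M ^ Module.finrank k A).restrictScalars k = ⊥ :=
    Submodule.finrank_eq_zero.1 (by omega)
  exact (Submodule.restrictScalars_eq_bot_iff k A A).1 h0

section Tjurina

variable {k : Type*} [Field k] {n : ℕ}

theorem sub_C_eval_mem (x : Fin n → k) (h : MvPolynomial (Fin n) k) :
    h - C (eval x h) ∈ Ideal.span (Set.range fun i => X i - C (x i)) := by
  induction h using MvPolynomial.induction_on with
  | C a => simp
  | add p q hp hq =>
    rw [map_add, map_add, add_sub_add_comm]
    exact add_mem hp hq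
  | mul_X p i hp =>
    rw [map_mul, map_mul, eval_X, show p * X i - C (eval x p) * C (x i) =
      X i * (p - C (eval x p)) + C (eval x p) * (X i - C (x i)) by ring]
    exact add_mem (Ideal.mul_mem_left _ _ hp)
      (Ideal.mul_mem_left _ _ (Ideal.subset_span (Set.mem_range_self i)))

theorem mem_span_X_sub_C_iff (x : Fin n → k) (h : MvPolynomial (Fin n) k) :
    h ∈ Ideal.span (Set.range fun i => X i - C (x i)) ↔ eval x h = 0 := by
  refine ⟨fun hh => ?_, fun hh => by simpa [hh] using sub_C_eval_mem x h⟩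
  have h1 : Ideal.span (Set.range fun i => X i - C (x i)) ≤ RingHom.ker (eval x) := by
    rw [Ideal.span_le]
    rintro _ ⟨i, rfl⟩
    simp [RingHom.mem_ker]
  exact h1 hh

theorem finite_quotient_of_pow_le {I : Ideal (MvPolynomial (Fin n) k)} {x : Fin n → k} {N : ℕ}
    (hN : Ideal.span (Set.range fun i => X i - C (x i)) ^ N ≤ I) :
    FiniteDimensional k (MvPolynomial (Fin n) k ⧸ I) := by
  have : Algebra.IsIntegral k (MvPolynomial (Fin n) k ⧸ I) := by
    refine ⟨fun z => ?_⟩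
    obtain ⟨h, rfl⟩ := Ideal.Quotient.mk_surjective z
    refine ⟨(Polynomial.X - Polynomial.C (eval x h)) ^ N, (Polynomial.monic_X_sub_C _).pow N, ?_⟩
    have h1 := hN (Ideal.pow_mem_pow (sub_C_eval_mem x h) N)
    rw [← Ideal.Quotient.eq_zero_iff_mem, map_pow, map_sub] at h1
    rw [Polynomial.eval₂_pow, Polynomial.eval₂_sub, Polynomial.eval₂_X, Polynomial.eval₂_C]
    exact h1
  exact Algebra.IsIntegral.finite

theorem pow_le_sup_pow {R : Type*} [CommRing R] {P I B : Ideal R} (hP : P.IsMaximal) {N τ : ℕ}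
    (hN : P ^ N ≤ I) (hτ : P ^ τ ≤ I) (m : ℕ) : B ^ τ ≤ I ⊔ B ^ m := by
  by_cases hB : B ≤ P
  · exact (Ideal.pow_right_mono hB τ).trans (hτ.trans le_sup_left)
  · have h1 : P ⊔ B = ⊤ := hP.out.2 _ (lt_of_le_of_ne le_sup_left fun h => hB (h ▸ le_sup_right))
    have h2 : P ^ N ⊔ B ^ m = ⊤ := Ideal.pow_sup_pow_eq_top h1
    exact le_top.trans (h2.symm.le.trans (sup_le_sup_right hN _))

end Tjurina

theorem mem_pow_of_mul_mem_pow {k : Type*} [Field k] [IsAlgClosed k] {n m τ : ℕ} (hn : n ≠ 0)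
    (hτ0 : τ ≠ 0) (hm : n * (τ + 1) ≤ m) {B : Ideal (MvPolynomial (Fin n) k)}
    {f g : MvPolynomial (Fin n) k} (hB : B ≠ ⊥) (hfg : f * g ∈ B ^ m)
    (hτ : B ^ τ ≤ Ideal.span ({f} ∪ Set.range fun i => pderiv i f) ⊔ B ^ m) :
    g ∈ B ^ (m - n * (τ + 1)) := by
  refine mem_pow_of_forall_charP (fun K _ _ p _ _ B f g hB hfg hτ => ?_) hB hfg hτ
  have hm' : τ + 1 ≤ m := (Nat.le_mul_of_pos_left _ (Nat.pos_of_ne_zero hn)).trans hm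
  rcases (show n = 1 ∨ 2 ≤ n by omega) with rfl | hn2
  · have : IsPrincipalIdealRing (MvPolynomial (Fin 1) K) := IsPrincipalIdealRing.of_surjective
      (uniqueAlgEquiv K (Fin 1)).symm (uniqueAlgEquiv K (Fin 1)).symm.surjective
    obtain ⟨b, rfl⟩ := (IsPrincipalIdealRing.principal B).principal
    have hb : Ideal.span (Set.range fun _ : Fin (0 + 1) => b) = Ideal.span {b} := by
      rw [Set.range_const]
    have h := mem_pow_of_mul_mem_pow_of_charP (N := 0) p hB hb.le
      (fun j => (congrArg (· ^ j) hb).symm.le) hm' hfg hτ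
    exact Ideal.pow_le_pow_right (by omega) h
  · obtain ⟨r, b, rfl⟩ :=
      Submodule.fg_iff_exists_fin_generating_family.1 (IsNoetherian.noetherian B)
    obtain ⟨c, hc, N, hN⟩ := exists_reduction b
    refine Ideal.pow_le_pow_right ?_ (mem_pow_of_mul_mem_pow_of_charP p hB hc hN hm' hfg hτ)
    obtain ⟨i, rfl⟩ := Nat.exists_eq_add_of_le hn2
    obtain ⟨j, rfl⟩ := Nat.exists_eq_succ_of_ne_zero hτ0
    have : j.succ + 1 + (2 + i) ≤ (2 + i) * (j.succ + 1) := by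
      simp only [Nat.succ_eq_add_one]; nlinarith [Nat.zero_le (i * j)]
    omega

/-- If the hypersurface `{f = 0}` is singular at exactly one point `x`, then the Tjurina
number `τ = dim_k 𝒪_x/(f, ∂f/∂x_1, …, ∂f/∂x_n)𝒪_x` is finite (here `𝒪_x = S` is the
localization at the maximal ideal `P` of `x`), and `n·(τ+1)` is a uniform Artin–Rees
number for `f`. -/
theorem uniformArtinRees_isolated_singularity {k : Type*} [Field k] [IsAlgClosed k]
    [CharZero k] {n : ℕ}
    (f : MvPolynomial (Fin n) k) (hf : f.totalDegree ≠ 0)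
    (x : Fin n → k)
    (hxsing : eval x f = 0 ∧ ∀ i, eval x (pderiv i f) = 0)
    (honly : ∀ y : Fin n → k, eval y f = 0 → (∀ i, eval y (pderiv i f) = 0) → y = x)
    (P : Ideal (MvPolynomial (Fin n) k)) [P.IsPrime]
    (hP : P = Ideal.span (Set.range fun i => X i - C (x i)))
    (S : Type*) [CommRing S] [Algebra (MvPolynomial (Fin n) k) S] [Algebra k S]
    [IsScalarTower k (MvPolynomial (Fin n) k) S] [IsLocalization.AtPrime S P]
    (J : Ideal S)
    (hJ : J = Ideal.map (algebraMap (MvPolynomial (Fin n) k) S)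
      (Ideal.span ({f} ∪ Set.range fun i => pderiv i f))) :
    FiniteDimensional k (S ⧸ J) ∧
    ∀ (b : Ideal (MvPolynomial (Fin n) k)) (m : ℕ),
      n * (Module.finrank k (S ⧸ J) + 1) ≤ m →
      b ^ m ⊓ Ideal.span {f} ≤ b ^ (m - n * (Module.finrank k (S ⧸ J) + 1)) *
        Ideal.span {f} := by
  set I : Ideal (MvPolynomial (Fin n) k) := Ideal.span ({f} ∪ Set.range fun i => pderiv i f)
  have hPv : P = vanishingIdeal k {x} := by
    ext h
    rw [hP, mem_span_X_sub_C_iff, mem_vanishingIdeal_singleton_iff, aeval_eq_eval]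
  have hPm : P.IsMaximal := isMaximal_iff_eq_vanishingIdeal_singleton.2 ⟨x, hPv⟩
  have hrad : I.radical = P := by
    rw [← vanishingIdeal_zeroLocus_eq_radical (K := k), hPv]
    congr 1
    rw [zeroLocus_span]
    ext y
    simp only [Set.mem_ofPred_eq, Set.mem_singleton_iff, Set.union_def, Set.mem_range]
    refine ⟨fun h => honly y (h f (Or.inl rfl)) fun i => h _ (Or.inr ⟨i, rfl⟩), ?_⟩
    rintro rfl p (rfl | ⟨i, rfl⟩)
    exacts [hxsing.1, hxsing.2 i]
  obtain ⟨N, hN⟩ := I.exists_radical_pow_le_of_fg (IsNoetherian.noetherian _)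
  rw [hrad] at hN
  have hfin : FiniteDimensional k (MvPolynomial (Fin n) k ⧸ I) :=
    finite_quotient_of_pow_le (x := x) (hP ▸ hN)
  set φ : MvPolynomial (Fin n) k →ₐ[k] S ⧸ J :=
    (Ideal.Quotient.mkₐ k J).comp (IsScalarTower.toAlgHom k (MvPolynomial (Fin n) k) S)
  have hφ : Function.Surjective φ := by
    subst hJ
    exact quotient_map_atPrime_surjective hPm hN
  have hker : I = RingHom.ker φ := by
    subst hJ
    exact (ker_quotient_map_atPrime hrad hPm).symm
  set ψ : (MvPolynomial (Fin n) k ⧸ I) ≃ₐ[k] S ⧸ J :=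
    (Ideal.quotientEquivAlgOfEq k hker).trans (Ideal.quotientKerAlgEquivOfSurjective hφ)
  rw [← ψ.toLinearEquiv.finrank_eq]
  refine ⟨ψ.toLinearEquiv.finiteDimensional, fun b m hm => ?_⟩
  set τ := Module.finrank k (MvPolynomial (Fin n) k ⧸ I) with hτdef
  have hIP : I ≤ P := hrad ▸ Ideal.le_radical
  have : Nontrivial (MvPolynomial (Fin n) k ⧸ I) :=
    Ideal.Quotient.nontrivial_iff.2 fun h => hPm.ne_top (top_le_iff.1 (h ▸ hIP))
  have hτ0 : τ ≠ 0 := Module.finrank_pos.ne'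
  have hn : n ≠ 0 := by
    rintro rfl
    exact hf (by rw [eq_C_of_isEmpty f, totalDegree_C])
  have hτ : P ^ τ ≤ I := by
    have h1 : P.map (Ideal.Quotient.mk I) ^ N = ⊥ := by
      rw [← Ideal.map_pow, Ideal.map_eq_bot_iff_le_ker, Ideal.mk_ker]; exact hN
    have h2 := pow_finrank_eq_bot (k := k) h1
    rwa [← Ideal.map_pow, Ideal.map_eq_bot_iff_le_ker, Ideal.mk_ker] at h2
  rintro _ ⟨hz, hzf⟩
  obtain ⟨g, rfl⟩ := Ideal.mem_span_singleton'.1 hzf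
  refine Ideal.mul_mem_mul ?_ (Ideal.mem_span_singleton_self f)
  rw [mul_comm] at hz
  by_cases hb : b = ⊥
  · have hm0 : m ≠ 0 := by
      rintro rfl
      simp [hn] at hm
    have hf0 : f ≠ 0 := by rintro rfl; simp at hf
    subst hb
    have h0 : f * g = 0 := by
      rwa [← Ideal.zero_eq_bot, zero_pow hm0, Ideal.zero_eq_bot, SetLike.mem_coe, Ideal.mem_bot] at hz
    rw [(mul_eq_zero.1 h0).resolve_left hf0]
    exact zero_mem _
  · exact mem_pow_of_mul_mem_pow hn hτ0 hm hb hz (pow_le_sup_pow hPm hN hτ m)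
end

section
/- Let T ⊂ ℂ^2 be a finite set of points and let 𝔮 = { f ∈ ℂ[x,y] : f(p) = 0 for all p ∈ T } be its vanishing ideal. If m ≥ 1 and f ∈ ℂ[x,y] satisfies f ∈ 𝔪_p^{2m} for every point p = (a,b) ∈ T, where 𝔪_p = (x − a, y − b) is the maximal ideal of p, then f ∈ 𝔮^m. -/
open MvPolynomial

theorem MvPolynomial.isCoprime_span_X_sub_C {σ K : Type*} [Field K] {p r : σ → K} (h : p ≠ r) :
    IsCoprime (Ideal.span (Set.range fun i => (X i - C (p i) : MvPolynomial σ K)))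
      (Ideal.span (Set.range fun i => (X i - C (r i) : MvPolynomial σ K))) := by
  obtain ⟨i, hi⟩ := Function.ne_iff.mp h
  rw [Ideal.isCoprime_iff_exists]
  refine ⟨C (-(p i - r i)⁻¹) * (X i - C (p i)), Ideal.mul_mem_left _ _ (Ideal.subset_span ⟨i, rfl⟩),
    C ((p i - r i)⁻¹) * (X i - C (r i)), Ideal.mul_mem_left _ _ (Ideal.subset_span ⟨i, rfl⟩), ?_⟩
  have hC : (C ((p i - r i)⁻¹) * (C (p i) - C (r i)) : MvPolynomial σ K) = 1 := by
    rw [← C_sub, ← C_mul, inv_mul_cancel₀ (sub_ne_zero.mpr hi), C_1]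
  rw [C_neg]
  linear_combination hC

theorem MvPolynomial.eval_eq_zero_of_mem_span_X_sub_C {σ K : Type*} [CommRing K] {p : σ → K}
    {g : MvPolynomial σ K} (hg : g ∈ Ideal.span (Set.range fun i => X i - C (p i))) :
    eval p g = 0 := by
  have hle : Ideal.span (Set.range fun i => X i - C (p i)) ≤ RingHom.ker (eval p) := by
    rw [Ideal.span_le]
    rintro _ ⟨i, rfl⟩
    simp [RingHom.mem_ker]
  exact hle hg

/-- (Points in the plane) Let `T ⊂ ℂ²` be a finite set of points with vanishing ideal
`𝔮 ⊆ ℂ[x,y]`. If `f` lies in `𝔪_p^{2m}` for every `p ∈ T` (i.e. `f` vanishes to order at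
least `2m` at each point of `T`), then `f ∈ 𝔮^m`. -/
theorem points_in_the_plane (T : Set (Fin 2 → ℂ)) (hT : T.Finite)
    (q : Ideal (MvPolynomial (Fin 2) ℂ))
    (hq : ∀ f : MvPolynomial (Fin 2) ℂ, f ∈ q ↔ ∀ p ∈ T, eval p f = 0)
    (m : ℕ) (hm : 1 ≤ m) (f : MvPolynomial (Fin 2) ℂ)
    (hmult : ∀ p ∈ T,
      f ∈ (Ideal.span (Set.range fun i => X i - C (p i))) ^ (2 * m)) :
    f ∈ q ^ m := by
  let M : (Fin 2 → ℂ) → Ideal (MvPolynomial (Fin 2) ℂ) :=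
    fun p => Ideal.span (Set.range fun i => X i - C (p i))
  have hle : ∏ p ∈ hT.toFinset, M p ≤ q := fun g hg => (hq g).mpr fun p hp =>
    eval_eq_zero_of_mem_span_X_sub_C
      (Ideal.le_of_dvd (Finset.dvd_prod_of_mem M (hT.mem_toFinset.mpr hp)) hg)
  refine Ideal.pow_right_mono hle m ?_
  rw [← Finset.prod_pow, Ideal.prod_eq_iInf_of_pairwise_isCoprime
    fun p _ r _ hpr => (isCoprime_span_X_sub_C hpr).pow]
  simp only [Ideal.mem_iInf]
  exact fun p hp => Ideal.pow_le_pow_right (by omega) (hmult p (hT.mem_toFinset.mp hp))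
end
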